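/- Fix α > 0 and d > 0. There exist a function r : (0, ∞) → ℝ, infinitely differentiable, satisfying 2s² r' r''' − s² (r'')² + 2s r' r'' − 4s (r')³ + (2r − 1/4)(r')² + 1 = 0 on (0, ∞), with lim_{s→0⁺} r(s) = (1 − 4α²)/8 and r(s) − ((3/2) s^{2/3} − α s^{1/3}) bounded as s → +∞, and constants C > 0 and N ∈ ℕ, such that for every integer n ≥ N and every t ∈ (0, d], writing s = 2nt, the leading coefficient satisfies γ_n(t) = (n! Γ(n + 1 + α))^{−1/2} · (1 + ((8 r(s) + 4α² − 1)/(32n)) (1 + ε_n(t))) with |ε_n(t)| ≤ C n^{−1/3}. -/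

import Mathlib

open MeasureTheory Set Filter Topology

/-- The singularly perturbed Laguerre weight `w(x; t, α) = x^α e^{-x - t/x}`. -/
noncomputable def pertLagWeight (α t x : ℝ) : ℝ := x ^ α * Real.exp (-x - t / x)

/-- The generalized moments of `e^{-x-t/x}` on `(0, ∞)`. -/
noncomputable def pertMoment (β t : ℝ) : ℝ :=
  ∫ x in Ioi (0:ℝ), x ^ β * Real.exp (-x - t / x)

lemma exp_neg_div_le {t x : ℝ} (ht : 0 < t) (hx : 0 < x) (m : ℕ) :
    Real.exp (-(t / x)) ≤ m.factorial / t ^ m * x ^ (m : ℝ) := by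
  have h1 := Real.pow_div_factorial_le_exp (t / x) (by positivity) m
  rw [Real.exp_neg, Real.rpow_natCast]
  calc (Real.exp (t / x))⁻¹ ≤ ((t / x) ^ m / m.factorial)⁻¹ := by
        apply inv_anti₀ _ h1
        positivity
    _ = m.factorial / t ^ m * x ^ m := by
        rw [div_pow]
        field_simp

lemma rpow_mul_exp_le {t x : ℝ} (ht : 0 < t) (hx : 0 < x) (β : ℝ) (m : ℕ) :
    x ^ β * Real.exp (-x - t / x)
      ≤ m.factorial / t ^ m * (Real.exp (-x) * x ^ (β + m)) := by
  have h1 := exp_neg_div_le ht hx m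
  rw [sub_eq_add_neg, Real.exp_add, Real.rpow_add hx]
  calc x ^ β * (Real.exp (-x) * Real.exp (-(t / x)))
      ≤ x ^ β * (Real.exp (-x) * (m.factorial / t ^ m * x ^ (m : ℝ))) := by
        have := Real.rpow_nonneg hx.le β
        gcongr
    _ = _ := by ring

lemma measurable_rpow_mul_exp (β t : ℝ) :
    Measurable (fun x : ℝ => x ^ β * Real.exp (-x - t / x)) := by
  fun_prop

lemma integrableOn_rpow_mul_exp {t : ℝ} (ht : 0 < t) (β : ℝ) :
    IntegrableOn (fun x : ℝ => x ^ β * Real.exp (-x - t / x)) (Ioi 0) := by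
  obtain ⟨m, hm⟩ := exists_nat_gt (-β)
  have h1 := (Real.GammaIntegral_convergent (s := β + m + 1) (by linarith)).const_mul
    (m.factorial / t ^ m : ℝ)
  refine Integrable.mono' h1 (measurable_rpow_mul_exp β t).aestronglyMeasurable ?_
  filter_upwards [ae_restrict_mem measurableSet_Ioi] with x hx
  have hx' : (0:ℝ) < x := hx
  rw [Real.norm_of_nonneg (by have := Real.rpow_nonneg hx'.le β; positivity)]
  have := rpow_mul_exp_le ht hx' β m
  simpa using this

lemma hasDerivAt_pertMoment {t : ℝ} (ht : 0 < t) (β : ℝ) :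
    HasDerivAt (pertMoment β) (-pertMoment (β - 1) t) t := by
  have key := hasDerivAt_integral_of_dominated_loc_of_deriv_le (μ := volume.restrict (Ioi (0:ℝ)))
    (F := fun τ x => x ^ β * Real.exp (-x - τ / x))
    (F' := fun τ x => -(x ^ (β - 1) * Real.exp (-x - τ / x)))
    (bound := fun x => x ^ (β - 1) * Real.exp (-x - (t / 2) / x)) (x₀ := t)
    (s := Ioi (t / 2)) (Ioi_mem_nhds (by linarith))
    (Eventually.of_forall fun τ => (measurable_rpow_mul_exp β τ).aestronglyMeasurable)
    (integrableOn_rpow_mul_exp ht β)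
    (measurable_rpow_mul_exp (β - 1) t).neg.aestronglyMeasurable
    ?_ (integrableOn_rpow_mul_exp (by linarith) _) ?_
  · have h2 := key.2
    rw [integral_neg] at h2
    exact h2
  · filter_upwards [ae_restrict_mem measurableSet_Ioi] with x hx τ hτ
    have hx' : (0:ℝ) < x := hx
    have hτ' : t / 2 < τ := hτ
    have := Real.rpow_nonneg hx'.le (β - 1)
    rw [norm_neg, Real.norm_of_nonneg (by positivity)]
    gcongr
  · filter_upwards [ae_restrict_mem measurableSet_Ioi] with x hx τ hτ
    have hx' : (0:ℝ) < x := hx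
    have h1 : HasDerivAt (fun τ : ℝ => -x - τ / x) (-(1 / x)) τ := by
      simpa using ((hasDerivAt_id τ).div_const x).const_sub (-x)
    have h2 := (h1.exp).const_mul (x ^ β)
    refine h2.congr_deriv ?_
    rw [Real.rpow_sub_one hx'.ne']
    field_simp

lemma pertMoment_rec {t β : ℝ} (ht : 0 < t) (hβ : 0 < β) :
    β * pertMoment (β - 1) t - pertMoment β t + t * pertMoment (β - 2) t = 0 := by
  have hb : ∀ x : ℝ, 0 < x → |x ^ β * Real.exp (-x - t / x)| ≤ x ^ β * Real.exp (-x) := by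
    intro x hx
    have := Real.rpow_nonneg hx.le β
    rw [abs_of_nonneg (by positivity)]
    gcongr
    have : 0 < t / x := by positivity
    linarith
  have hF := integral_Ioi_of_hasDerivAt_of_tendsto (a := (0:ℝ)) (m := (0:ℝ))
    (f := fun x : ℝ => x ^ β * Real.exp (-x - t / x))
    (f' := fun x : ℝ => β * (x ^ (β - 1) * Real.exp (-x - t / x))
      - (x ^ β * Real.exp (-x - t / x)) + t * (x ^ (β - 2) * Real.exp (-x - t / x)))
    ?_ ?_ ?_ ?_
  · have i0 := integrableOn_rpow_mul_exp ht β
    have i1 := integrableOn_rpow_mul_exp ht (β - 1)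
    have i2 := integrableOn_rpow_mul_exp ht (β - 2)
    have e1 := integral_add ((i1.const_mul β).sub i0) (i2.const_mul t)
    have e2 := integral_sub (i1.const_mul β) i0
    simp only [Pi.sub_apply] at e1
    rw [e1, e2, integral_const_mul, integral_const_mul] at hF
    simpa [pertMoment, Real.zero_rpow hβ.ne'] using hF
  · have h0 : (0:ℝ) ^ β * Real.exp (-0 - t / 0) = 0 := by simp [Real.zero_rpow hβ.ne']
    rw [ContinuousWithinAt, h0]
    refine squeeze_zero_norm' (a := fun x => x ^ β) ?_ ?_
    · filter_upwards [self_mem_nhdsWithin] with x hx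
      rcases eq_or_lt_of_le (show (0:ℝ) ≤ x from hx) with rfl | hx'
      · simp [Real.zero_rpow hβ.ne']
      · refine (hb x hx').trans ?_
        have := Real.rpow_nonneg hx'.le β
        exact mul_le_of_le_one_right this (Real.exp_le_one_iff.2 (by linarith))
    · have := (Real.continuousAt_rpow_const 0 β (Or.inr hβ.le)).tendsto
      rw [Real.zero_rpow hβ.ne'] at this
      exact this.mono_left nhdsWithin_le_nhds
  · intro x hx
    have hx' : (0:ℝ) < x := hx
    have h1 : HasDerivAt (fun x : ℝ => -x - t / x) (-1 + t / x ^ 2) x := by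
      have := (hasDerivAt_id x).neg.sub ((hasDerivAt_const x t).div (hasDerivAt_id x) hx'.ne')
      refine this.congr_deriv ?_
      simp only [id]
      ring
    have h2 := (Real.hasDerivAt_rpow_const (p := β) (Or.inl hx'.ne')).mul h1.exp
    refine h2.congr_deriv ?_
    have e2 : x ^ (β - 2) = x ^ β / x ^ 2 := by
      rw [Real.rpow_sub hx']; norm_num
    rw [e2]; ring
  · exact (((integrableOn_rpow_mul_exp ht (β - 1)).const_mul β).sub
      (integrableOn_rpow_mul_exp ht β)).add ((integrableOn_rpow_mul_exp ht (β - 2)).const_mul t)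
  · refine squeeze_zero_norm' (a := fun x => x ^ β * Real.exp (-x)) ?_ ?_
    · filter_upwards [eventually_gt_atTop 0] with x hx
      exact hb x hx
    · simpa using tendsto_rpow_mul_exp_neg_mul_atTop_nhds_zero β 1 one_pos

lemma tendsto_pertMoment {β : ℝ} (hβ : 0 < β) :
    Tendsto (pertMoment β) (𝓝[>] 0) (𝓝 (Real.Gamma (β + 1))) := by
  rw [Real.Gamma_eq_integral (by linarith)]
  refine tendsto_integral_filter_of_dominated_convergence
    (fun x => Real.exp (-x) * x ^ (β + 1 - 1)) ?_ ?_
    (Real.GammaIntegral_convergent (by linarith)) ?_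
  · exact Eventually.of_forall fun τ => (measurable_rpow_mul_exp β τ).aestronglyMeasurable
  · filter_upwards [self_mem_nhdsWithin] with t ht
    have ht' : (0:ℝ) < t := ht
    filter_upwards [ae_restrict_mem measurableSet_Ioi] with x hx
    have hx' : (0:ℝ) < x := hx
    have := Real.rpow_nonneg hx'.le β
    rw [Real.norm_of_nonneg (by positivity), add_sub_cancel_right, mul_comm]
    gcongr
    have : 0 < t / x := by positivity
    linarith
  · filter_upwards [ae_restrict_mem measurableSet_Ioi] with x hx
    have : Continuous fun t : ℝ => x ^ β * Real.exp (-x - t / x) := by fun_prop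
    have h := (this.tendsto 0).mono_left (nhdsWithin_le_nhds (s := Ioi 0))
    simpa [mul_comm] using h

open Polynomial in
/-- The functional `p ↦ ∫ p(x) x^{α-k} e^{-x-t/x} dx` on polynomials. -/
noncomputable def pertFunctional (α t : ℝ) (k : ℕ) : ℝ[X] →ₗ[ℝ] ℝ :=
  Polynomial.lsum fun i => pertMoment (α + i - k) t • LinearMap.id

namespace pertFunctional

open Polynomial

lemma eq_sum_range {α t : ℝ} {k N : ℕ} {p : ℝ[X]} (h : p.natDegree < N) :
    pertFunctional α t k p
      = ∑ i ∈ Finset.range N, p.coeff i * pertMoment (α + i - k) t := by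
  rw [pertFunctional, Polynomial.lsum_apply, Polynomial.sum_over_range' _ _ N h]
  · simp [mul_comm]
  · simp

lemma map_X_pow (α t : ℝ) (k i : ℕ) :
    pertFunctional α t k (X ^ i) = pertMoment (α + i - k) t := by
  rw [eq_sum_range (N := i + 1) (by simp), Finset.sum_eq_single i]
  · simp
  · intro b _ hb
    simp [coeff_X_pow, hb]
  · simp

lemma ext_X_pow {f g : ℝ[X] →ₗ[ℝ] ℝ} (h : ∀ i : ℕ, f (X ^ i) = g (X ^ i)) (p : ℝ[X]) :
    f p = g p := by
  have : f = g := by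
    ext i
    simpa [Polynomial.X_pow_eq_monomial] using h i
  rw [this]

lemma map_C_mul (α t : ℝ) (k : ℕ) (c : ℝ) (p : ℝ[X]) :
    pertFunctional α t k (C c * p) = c * pertFunctional α t k p := by
  rw [← smul_eq_C_mul, map_smul, smul_eq_mul]

lemma succ_X_mul (α t : ℝ) (k : ℕ) (p : ℝ[X]) :
    pertFunctional α t (k + 1) (X * p) = pertFunctional α t k p := by
  refine ext_X_pow (f := (pertFunctional α t (k + 1)) ∘ₗ LinearMap.mulLeft ℝ X)
    (g := pertFunctional α t k) (fun i => ?_) p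
  simp only [LinearMap.comp_apply, LinearMap.mulLeft_apply, ← pow_succ', map_X_pow]
  congr 1
  push_cast
  ring

lemma integrable {α t : ℝ} (ht : 0 < t) (k : ℕ) (p : ℝ[X]) :
    IntegrableOn (fun x : ℝ => p.eval x * (x ^ (α - k) * Real.exp (-x - t / x))) (Ioi 0) := by
  induction p using Polynomial.induction_on' with
  | add p q hp hq =>
    refine (hp.add hq).congr_fun (fun x _ => ?_) measurableSet_Ioi
    simp [add_mul]
  | monomial i c =>
    have h := (integrableOn_rpow_mul_exp ht (α + i - k)).const_mul c
    refine IntegrableOn.congr_fun h (fun x hx => ?_) measurableSet_Ioi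
    have hx' : (0:ℝ) < x := hx
    have e : α + i - k = i + (α - k) := by ring
    simp only [eval_monomial]
    rw [e, Real.rpow_add hx', Real.rpow_natCast]
    ring

lemma eq_integral {α t : ℝ} (ht : 0 < t) (k : ℕ) (p : ℝ[X]) :
    pertFunctional α t k p
      = ∫ x in Ioi (0:ℝ), p.eval x * (x ^ (α - k) * Real.exp (-x - t / x)) := by
  induction p using Polynomial.induction_on' with
  | add p q hp hq =>
    rw [map_add, hp, hq, ← integral_add (integrable ht k p) (integrable ht k q)]
    simp [add_mul]
  | monomial i c =>
    rw [← C_mul_X_pow_eq_monomial, map_C_mul, map_X_pow, pertMoment, ← integral_const_mul]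
    refine setIntegral_congr_fun measurableSet_Ioi (fun x hx => ?_)
    have hx' : (0:ℝ) < x := hx
    have e : α + i - k = i + (α - k) := by ring
    simp only [eval_mul, eval_C, eval_pow, eval_X]
    rw [e, Real.rpow_add hx', Real.rpow_natCast]
    ring

lemma sq_pos {α t : ℝ} (ht : 0 < t) (k : ℕ) {p : ℝ[X]} (hp : p ≠ 0) :
    0 < pertFunctional α t k (p * p) := by
  rw [eq_integral ht, setIntegral_pos_iff_support_of_nonneg_ae _ (integrable ht k _)]
  · have hfin : (p.roots.toFinset : Set ℝ).Finite := Finset.finite_toSet _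
    have hsub : Ioi (0:ℝ) \ (p.roots.toFinset : Set ℝ) ⊆
        Function.support (fun x : ℝ => (p * p).eval x
          * (x ^ (α - k) * Real.exp (-x - t / x))) ∩ Ioi 0 := by
      rintro x ⟨hx, hxr⟩
      have hx' : (0:ℝ) < x := hx
      have hne : p.eval x ≠ 0 := by
        intro h0
        apply hxr
        simp [hp, h0]
      refine ⟨?_, hx⟩
      have := Real.rpow_pos_of_pos hx' (α - k)
      simp [hne, this.ne']
    refine lt_of_lt_of_le ?_ (measure_mono hsub)
    rw [measure_sdiff_null (hfin.measure_zero _)]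
    simp
  · filter_upwards [ae_restrict_mem measurableSet_Ioi] with x hx
    have hx' : (0:ℝ) < x := hx
    have := Real.rpow_nonneg hx'.le (α - k)
    simp only [Pi.zero_apply, eval_mul]
    have := mul_self_nonneg (p.eval x)
    positivity

lemma sq_nonneg {α t : ℝ} (ht : 0 < t) (k : ℕ) (p : ℝ[X]) :
    0 ≤ pertFunctional α t k (p * p) := by
  by_cases hp : p = 0
  · simp [hp]
  · exact (sq_pos ht k hp).le

lemma by_parts {α t : ℝ} (hα : 0 < α) (ht : 0 < t) (p : ℝ[X]) :
    pertFunctional α t 0 (derivative p) + α * pertFunctional α t 1 p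
      - pertFunctional α t 0 p + t * pertFunctional α t 2 p = 0 := by
  refine ext_X_pow (f := (pertFunctional α t 0) ∘ₗ derivative + α • pertFunctional α t 1
    - pertFunctional α t 0 + t • pertFunctional α t 2) (g := 0) (fun i => ?_) p
  have h := pertMoment_rec ht (show 0 < α + i by positivity)
  simp only [LinearMap.add_apply, LinearMap.sub_apply, LinearMap.smul_apply, LinearMap.comp_apply,
    smul_eq_mul, LinearMap.zero_apply, derivative_X_pow, map_C_mul, map_X_pow]
  rcases i with _ | i
  · simp at h ⊢
    linarith
  · have e : α + ((i + 1 - 1 : ℕ) : ℝ) - ((0 : ℕ) : ℝ) = α + ((i + 1 : ℕ) : ℝ) - ((1 : ℕ) : ℝ) := by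
      push_cast; simp; ring
    rw [e]
    push_cast at h ⊢
    simp only [sub_zero]
    linarith

end pertFunctional

open Polynomial in
/-- Coefficientwise differentiability of a family of polynomials of bounded degree. -/
def HasPolyDerivAt (p : ℝ → ℝ[X]) (q : ℝ[X]) (t : ℝ) : Prop :=
  (∃ N, ∀ᶠ τ in 𝓝 t, (p τ).natDegree < N) ∧
    ∀ i, HasDerivAt (fun τ => (p τ).coeff i) (q.coeff i) t

namespace HasPolyDerivAt

open Polynomial

lemma natDegree_lt {p : ℝ → ℝ[X]} {q : ℝ[X]} {t : ℝ} {N : ℕ} (h : HasPolyDerivAt p q t)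
    (hN : ∀ᶠ τ in 𝓝 t, (p τ).natDegree < N) : q.natDegree < N := by
  rcases Nat.eq_zero_or_pos N with rfl | hpos
  · simpa using hN.self_of_nhds
  by_contra! hq
  have hq0 : q.coeff q.natDegree = 0 := by
    refine (h.2 q.natDegree).unique ?_
    refine (hasDerivAt_const t (0:ℝ)).congr_of_eventuallyEq ?_
    filter_upwards [hN] with τ hτ
    exact coeff_eq_zero_of_natDegree_lt (hτ.trans_le hq)
  have : q = 0 := by simpa using hq0
  rw [this] at hq
  simp at hq
  omega

lemma const (p : ℝ[X]) (t : ℝ) : HasPolyDerivAt (fun _ => p) 0 t :=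
  ⟨⟨p.natDegree + 1, by simp⟩, fun i => by simpa using hasDerivAt_const t (p.coeff i)⟩

lemma mul {p₁ p₂ : ℝ → ℝ[X]} {q₁ q₂ : ℝ[X]} {t : ℝ} (h₁ : HasPolyDerivAt p₁ q₁ t)
    (h₂ : HasPolyDerivAt p₂ q₂ t) :
    HasPolyDerivAt (fun τ => p₁ τ * p₂ τ) (q₁ * p₂ t + p₁ t * q₂) t := by
  obtain ⟨N₁, hN₁⟩ := h₁.1
  obtain ⟨N₂, hN₂⟩ := h₂.1
  refine ⟨⟨N₁ + N₂, ?_⟩, fun i => ?_⟩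
  · filter_upwards [hN₁, hN₂] with τ h1 h2
    have := natDegree_mul_le (p := p₁ τ) (q := p₂ τ)
    omega
  · simp only [coeff_mul, coeff_add, ← Finset.sum_add_distrib]
    exact HasDerivAt.fun_sum fun x _ => (h₁.2 x.1).mul (h₂.2 x.2)

lemma functional {α t : ℝ} (ht : 0 < t) (k : ℕ) {p : ℝ → ℝ[X]} {q : ℝ[X]}
    (h : HasPolyDerivAt p q t) :
    HasDerivAt (fun τ => pertFunctional α τ k (p τ))
      (pertFunctional α t k q - pertFunctional α t (k + 1) (p t)) t := by
  obtain ⟨N, hN⟩ := h.1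
  have hq := h.natDegree_lt hN
  rw [pertFunctional.eq_sum_range hq, pertFunctional.eq_sum_range hN.self_of_nhds,
    ← Finset.sum_sub_distrib]
  have h1 : HasDerivAt (fun τ => ∑ i ∈ Finset.range N, (p τ).coeff i * pertMoment (α + i - k) τ)
      (∑ i ∈ Finset.range N, (q.coeff i * pertMoment (α + i - k) t
        - (p t).coeff i * pertMoment (α + i - (k + 1 : ℕ)) t)) t := by
    refine HasDerivAt.fun_sum fun i _ => ?_
    have h2 := (h.2 i).mul (hasDerivAt_pertMoment ht (α + i - k))
    refine h2.congr_deriv ?_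
    have e : α + i - ((k + 1 : ℕ) : ℝ) = α + i - k - 1 := by push_cast; ring
    rw [e]
    ring
  refine h1.congr_of_eventuallyEq ?_
  filter_upwards [hN] with τ hτ
  exact pertFunctional.eq_sum_range hτ

end HasPolyDerivAt

namespace HasPolyDerivAt

open Polynomial

lemma congr {p₁ p₂ : ℝ → ℝ[X]} {q : ℝ[X]} {t : ℝ} (h : HasPolyDerivAt p₁ q t)
    (he : p₂ =ᶠ[𝓝 t] p₁) : HasPolyDerivAt p₂ q t := by
  obtain ⟨N, hN⟩ := h.1
  refine ⟨⟨N, ?_⟩, fun i => (h.2 i).congr_of_eventuallyEq ?_⟩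
  · filter_upwards [hN, he] with τ h1 h2
    rwa [h2]
  · filter_upwards [he] with τ h2
    rw [h2]

lemma add {p₁ p₂ : ℝ → ℝ[X]} {q₁ q₂ : ℝ[X]} {t : ℝ} (h₁ : HasPolyDerivAt p₁ q₁ t)
    (h₂ : HasPolyDerivAt p₂ q₂ t) : HasPolyDerivAt (fun τ => p₁ τ + p₂ τ) (q₁ + q₂) t := by
  obtain ⟨N₁, hN₁⟩ := h₁.1
  obtain ⟨N₂, hN₂⟩ := h₂.1
  refine ⟨⟨max N₁ N₂, ?_⟩, fun i => ?_⟩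
  · filter_upwards [hN₁, hN₂] with τ h1 h2
    exact (natDegree_add_le _ _).trans_lt (max_lt_max h1 h2)
  · simp only [coeff_add]
    exact (h₁.2 i).add (h₂.2 i)

lemma C_fun {f : ℝ → ℝ} {f' t : ℝ} (h : HasDerivAt f f' t) :
    HasPolyDerivAt (fun τ => C (f τ)) (C f') t := by
  refine ⟨⟨1, by simp⟩, fun i => ?_⟩
  rcases i with _ | i
  · simpa using h
  · simpa [coeff_C] using hasDerivAt_const t (0:ℝ)

lemma sum {ι : Type*} (s : Finset ι) {p : ι → ℝ → ℝ[X]} {q : ι → ℝ[X]} {t : ℝ}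
    (h : ∀ i ∈ s, HasPolyDerivAt (p i) (q i) t) :
    HasPolyDerivAt (fun τ => ∑ i ∈ s, p i τ) (∑ i ∈ s, q i) t := by
  classical
  induction s using Finset.induction_on with
  | empty => simpa using const 0 t
  | insert i s hi ih =>
    simp only [Finset.sum_insert hi]
    exact (h i (Finset.mem_insert_self i s)).add
      (ih fun j hj => h j (Finset.mem_insert_of_mem hj))

end HasPolyDerivAt

open Polynomial in
/-- `p n t` are the monic orthogonal polynomials of the perturbed Laguerre weight with squared
norms `h n t`. -/
structure IsPertOPS (α : ℝ) (p : ℕ → ℝ → ℝ[X]) (h : ℕ → ℝ → ℝ) : Prop where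
  alpha_pos : 0 < α
  monic : ∀ n t, 0 < t → (p n t).Monic
  natDegree : ∀ n t, 0 < t → (p n t).natDegree = n
  orth : ∀ j k t, 0 < t → pertFunctional α t 0 (p j t * p k t) = if j = k then h j t else 0

namespace IsPertOPS

open Polynomial

variable {α : ℝ} {p : ℕ → ℝ → ℝ[X]} {h : ℕ → ℝ → ℝ}

lemma coeff_self (S : IsPertOPS α p h) {t : ℝ} (ht : 0 < t) (n : ℕ) : (p n t).coeff n = 1 := by
  have := S.monic n t ht
  rw [Monic, leadingCoeff, S.natDegree n t ht] at this
  exact this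

lemma coeff_gt (S : IsPertOPS α p h) {t : ℝ} (ht : 0 < t) {n i : ℕ} (hi : n < i) :
    (p n t).coeff i = 0 :=
  coeff_eq_zero_of_natDegree_lt (by rwa [S.natDegree n t ht])

lemma ne_zero (S : IsPertOPS α p h) {t : ℝ} (ht : 0 < t) (n : ℕ) : p n t ≠ 0 :=
  (S.monic n t ht).ne_zero

lemma norm_eq (S : IsPertOPS α p h) {t : ℝ} (ht : 0 < t) (n : ℕ) :
    pertFunctional α t 0 (p n t * p n t) = h n t := by
  rw [S.orth n n t ht, if_pos rfl]

lemma norm_pos (S : IsPertOPS α p h) {t : ℝ} (ht : 0 < t) (n : ℕ) : 0 < h n t := by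
  rw [← S.norm_eq ht]
  exact pertFunctional.sq_pos ht 0 (S.ne_zero ht n)

lemma functional_eq_zero (S : IsPertOPS α p h) {t : ℝ} (ht : 0 < t) {f : ℝ[X]} {n : ℕ}
    (hf : ∀ j < n, pertFunctional α t 0 (p j t * f) = 0) {q : ℝ[X]}
    (hq : ∀ i, n ≤ i → q.coeff i = 0) : pertFunctional α t 0 (q * f) = 0 := by
  induction n generalizing q with
  | zero =>
    have : q = 0 := by
      ext i
      simpa using hq i (Nat.zero_le i)
    simp [this]
  | succ n ih =>
    have h1 : pertFunctional α t 0 ((q - C (q.coeff n) * p n t) * f) = 0 := by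
      refine ih (fun j hj => hf j (by omega)) fun i hi => ?_
      rcases eq_or_lt_of_le hi with rfl | hi'
      · simp [S.coeff_self ht]
      · simp [S.coeff_gt ht hi', hq i hi']
    have h2 : q * f = (q - C (q.coeff n) * p n t) * f + C (q.coeff n) * (p n t * f) := by ring
    rw [h2, map_add, h1, pertFunctional.map_C_mul, hf n (by omega)]
    simp

lemma pairing_lt (S : IsPertOPS α p h) {t : ℝ} (ht : 0 < t) {n : ℕ} {q : ℝ[X]}
    (hq : ∀ i, n ≤ i → q.coeff i = 0) : pertFunctional α t 0 (q * p n t) = 0 :=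
  S.functional_eq_zero ht (fun j hj => by rw [S.orth j n t ht, if_neg (by omega)]) hq

lemma pairing (S : IsPertOPS α p h) {t : ℝ} (ht : 0 < t) {n : ℕ} {q : ℝ[X]}
    (hq : ∀ i, n < i → q.coeff i = 0) :
    pertFunctional α t 0 (q * p n t) = q.coeff n * h n t := by
  have h1 : pertFunctional α t 0 ((q - C (q.coeff n) * p n t) * p n t) = 0 := by
    refine S.pairing_lt ht fun i hi => ?_
    rcases eq_or_lt_of_le hi with rfl | hi'
    · simp [S.coeff_self ht]
    · simp [S.coeff_gt ht hi', hq i hi']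
  have h2 : q * p n t
      = (q - C (q.coeff n) * p n t) * p n t + C (q.coeff n) * (p n t * p n t) := by ring
  rw [h2, map_add, h1, pertFunctional.map_C_mul, S.norm_eq ht]
  simp

lemma eq_zero_of_orth (S : IsPertOPS α p h) {t : ℝ} (ht : 0 < t) {n : ℕ} {r : ℝ[X]}
    (hr : ∀ i, n ≤ i → r.coeff i = 0)
    (ho : ∀ j < n, pertFunctional α t 0 (p j t * r) = 0) : r = 0 := by
  by_contra hne
  exact (pertFunctional.sq_pos (α := α) ht 0 hne).ne' (S.functional_eq_zero ht ho hr)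

lemma eq_span_two (S : IsPertOPS α p h) {t : ℝ} (ht : 0 < t) {n : ℕ} {q : ℝ[X]}
    (hq : ∀ i, n + 1 < i → q.coeff i = 0)
    (ho : ∀ j < n, pertFunctional α t 0 (p j t * q) = 0) :
    q = C (pertFunctional α t 0 (p (n + 1) t * q) / h (n + 1) t) * p (n + 1) t
      + C (pertFunctional α t 0 (p n t * q) / h n t) * p n t := by
  rw [← sub_eq_zero]
  refine S.eq_zero_of_orth (n := n + 2) ht (fun i hi => ?_) fun j hj => ?_
  · simp [hq i (by omega), S.coeff_gt ht (show n + 1 < i by omega),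
      S.coeff_gt ht (show n < i by omega)]
  · have hh := (S.norm_pos ht n).ne'
    have hh1 := (S.norm_pos ht (n + 1)).ne'
    have e : ∀ c d : ℝ, p j t * (q - (C c * p (n + 1) t + C d * p n t))
        = p j t * q - (C c * (p j t * p (n + 1) t) + C d * (p j t * p n t)) := by
      intro c d; ring
    rw [e, map_sub, map_add, pertFunctional.map_C_mul, pertFunctional.map_C_mul,
      S.orth j _ t ht, S.orth j _ t ht]
    rcases lt_trichotomy j n with hlt | rfl | hgt
    · rw [if_neg (by omega), if_neg (by omega), ho j hlt]
      simp
    · rw [if_neg (by omega), if_pos rfl]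
      field_simp
      ring
    · obtain rfl : j = n + 1 := by omega
      rw [if_pos rfl, if_neg (by omega)]
      field_simp
      ring

lemma gram_schmidt (S : IsPertOPS α p h) {t : ℝ} (ht : 0 < t) (n : ℕ) :
    p n t = X ^ n + ∑ j ∈ Finset.range n,
      C (-(pertFunctional α t 0 (p j t * X ^ n) / h j t)) * p j t := by
  rw [← sub_eq_zero]
  refine S.eq_zero_of_orth (n := n) ht (fun i hi => ?_) fun j hj => ?_
  · have hs : (∑ j ∈ Finset.range n,
        C (-(pertFunctional α t 0 (p j t * X ^ n) / h j t)) * p j t).coeff i = 0 := by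
      rw [finsetSum_coeff]
      refine Finset.sum_eq_zero fun j hj => ?_
      rw [coeff_C_mul, S.coeff_gt ht (by have := Finset.mem_range.1 hj; omega), mul_zero]
    rw [coeff_sub, coeff_add, hs, coeff_X_pow]
    rcases eq_or_lt_of_le hi with rfl | hi'
    · simp [S.coeff_self ht]
    · simp [S.coeff_gt ht hi', hi'.ne']
  · have hh := (S.norm_pos ht j).ne'
    rw [mul_sub, mul_add, map_sub, map_add, Finset.mul_sum, map_sum,
      Finset.sum_eq_single j, S.orth j n t ht, if_neg (by omega)]
    · have e : ∀ c : ℝ, p j t * (C c * p j t) = C c * (p j t * p j t) := by intro c; ring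
      rw [e, pertFunctional.map_C_mul, S.norm_eq ht]
      field_simp
      ring
    · intro k _ hk
      have e : ∀ c : ℝ, p j t * (C c * p k t) = C c * (p j t * p k t) := by intro c; ring
      rw [e, pertFunctional.map_C_mul, S.orth j k t ht, if_neg (by omega), mul_zero]
    · intro hj'
      exact absurd (Finset.mem_range.2 hj) hj'

lemma exists_hasPolyDerivAt (S : IsPertOPS α p h) {t : ℝ} (ht : 0 < t) (n : ℕ) :
    ∃ q, HasPolyDerivAt (p n) q t := by
  induction n using Nat.strong_induction_on with
  | _ n ih =>
    have hc : ∀ j, ∃ q, j < n → HasPolyDerivAt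
        (fun τ => C (-(pertFunctional α τ 0 (p j τ * X ^ n) / h j τ)) * p j τ) q t := by
      intro j
      by_cases hj : j < n
      swap
      · exact ⟨0, fun h => absurd h hj⟩
      obtain ⟨q, hq⟩ := ih j hj
      have h1 := (hq.mul (HasPolyDerivAt.const (X ^ n) t)).functional (α := α) ht 0
      have h2 := (hq.mul hq).functional (α := α) ht 0
      have h3 : HasDerivAt (h j) _ t := h2.congr_of_eventuallyEq (by
        filter_upwards [lt_mem_nhds ht] with τ hτ
        exact (S.norm_eq hτ j).symm)
      exact ⟨_, fun _ =>
        (HasPolyDerivAt.C_fun ((h1.div h3 (S.norm_pos ht j).ne').neg)).mul hq⟩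
    choose q hq using hc
    refine ⟨_, ((HasPolyDerivAt.const (X ^ n) t).add (HasPolyDerivAt.sum (Finset.range n)
      fun j hj => hq j (Finset.mem_range.1 hj))).congr ?_⟩
    filter_upwards [lt_mem_nhds ht] with τ hτ
    exact S.gram_schmidt hτ n

lemma deriv_coeff (S : IsPertOPS α p h) {t : ℝ} (ht : 0 < t) {n : ℕ} {q : ℝ[X]}
    (hq : HasPolyDerivAt (p n) q t) {i : ℕ} (hi : n ≤ i) : q.coeff i = 0 := by
  refine (hq.2 i).unique ?_
  rcases eq_or_lt_of_le hi with rfl | hi'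
  · refine (hasDerivAt_const t (1:ℝ)).congr_of_eventuallyEq ?_
    filter_upwards [lt_mem_nhds ht] with τ hτ
    exact S.coeff_self hτ n
  · refine (hasDerivAt_const t (0:ℝ)).congr_of_eventuallyEq ?_
    filter_upwards [lt_mem_nhds ht] with τ hτ
    exact S.coeff_gt hτ hi'

lemma deriv_pairing (S : IsPertOPS α p h) {t : ℝ} (ht : 0 < t) {n : ℕ} {q : ℝ[X]}
    (hq : HasPolyDerivAt (p n) q t) {g : ℝ[X]} (hg : ∀ i, n ≤ i → g.coeff i = 0) :
    pertFunctional α t 0 (g * q) = pertFunctional α t 1 (g * p n t) := by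
  have h1 := ((HasPolyDerivAt.const g t).mul hq).functional (α := α) ht 0
  have h2 : HasDerivAt (fun τ => pertFunctional α τ 0 (g * p n τ)) 0 t := by
    refine (hasDerivAt_const t (0:ℝ)).congr_of_eventuallyEq ?_
    filter_upwards [lt_mem_nhds ht] with τ hτ
    exact S.pairing_lt hτ hg
  have h3 := h1.unique h2
  simp only [zero_mul, zero_add] at h3
  linarith

lemma hasDerivAt_norm (S : IsPertOPS α p h) {t : ℝ} (ht : 0 < t) (n : ℕ) :
    HasDerivAt (h n) (-pertFunctional α t 1 (p n t * p n t)) t := by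
  obtain ⟨q, hq⟩ := S.exists_hasPolyDerivAt ht n
  have h2 := (hq.mul hq).functional (α := α) ht 0
  have h4 := S.pairing_lt ht (fun i hi => S.deriv_coeff ht hq hi)
  have h3 : HasDerivAt (h n) _ t := h2.congr_of_eventuallyEq (by
    filter_upwards [lt_mem_nhds ht] with τ hτ
    exact (S.norm_eq hτ n).symm)
  refine h3.congr_deriv ?_
  rw [map_add, mul_comm (p n t) q, h4]
  simp

lemma functional_two (S : IsPertOPS α p h) {t : ℝ} (ht : 0 < t) (n : ℕ) :
    α * pertFunctional α t 1 (p n t * p n t) + t * pertFunctional α t 2 (p n t * p n t)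
      = h n t := by
  have h1 := pertFunctional.by_parts S.alpha_pos ht (p n t * p n t)
  have h2 : pertFunctional α t 0 (derivative (p n t) * p n t) = 0 := by
    refine S.pairing_lt ht fun i hi => ?_
    rw [coeff_derivative, S.coeff_gt ht (by omega), zero_mul]
  rw [derivative_mul, map_add, mul_comm (p n t) (derivative _), h2, S.norm_eq ht] at h1
  linarith

lemma functional_X (S : IsPertOPS α p h) {t : ℝ} (ht : 0 < t) (n : ℕ) :
    pertFunctional α t 0 (X * (p n t * p n t))
      = (2 * n + 1 + α) * h n t + t * pertFunctional α t 1 (p n t * p n t) := by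
  have h1 := pertFunctional.by_parts S.alpha_pos ht (X * (p n t * p n t))
  have h2 : pertFunctional α t 0 (X * derivative (p n t) * p n t) = n * h n t := by
    rw [S.pairing ht]
    · rcases n with _ | n
      · simp
      · rw [coeff_X_mul, coeff_derivative, S.coeff_self ht]
        push_cast
        ring
    · intro i hi
      rcases i with _ | i
      · omega
      · rw [coeff_X_mul, coeff_derivative, S.coeff_gt ht (by omega), zero_mul]
  have e : derivative (X * (p n t * p n t))
      = p n t * p n t + X * derivative (p n t) * p n t + X * derivative (p n t) * p n t := by
    rw [derivative_mul, derivative_mul, derivative_X]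
    ring
  have e2 : pertFunctional α t 2 (X * (p n t * p n t)) = pertFunctional α t 1 (p n t * p n t) :=
    pertFunctional.succ_X_mul α t 1 _
  have e1 : pertFunctional α t 1 (X * (p n t * p n t)) = pertFunctional α t 0 (p n t * p n t) :=
    pertFunctional.succ_X_mul α t 0 _
  rw [e, e1, e2, map_add, map_add, h2, S.norm_eq ht] at h1
  linarith

end IsPertOPS

namespace IsPertOPS

open Polynomial

variable {α : ℝ} {p : ℕ → ℝ → ℝ[X]} {h : ℕ → ℝ → ℝ}

lemma functional_two_cross (S : IsPertOPS α p h) {t : ℝ} (ht : 0 < t) (n : ℕ) :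
    (n + 1) * h n t + α * pertFunctional α t 1 (p (n + 1) t * p n t)
      + t * pertFunctional α t 2 (p (n + 1) t * p n t) = 0 := by
  have h1 := pertFunctional.by_parts S.alpha_pos ht (p (n + 1) t * p n t)
  have h2 : pertFunctional α t 0 (derivative (p (n + 1) t) * p n t) = (n + 1) * h n t := by
    rw [S.pairing ht]
    · rw [coeff_derivative, S.coeff_self ht]
      ring
    · intro i hi
      rw [coeff_derivative, S.coeff_gt ht (by omega), zero_mul]
  have h3 : pertFunctional α t 0 (derivative (p n t) * p (n + 1) t) = 0 := by
    refine S.pairing_lt ht fun i hi => ?_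
    rw [coeff_derivative, S.coeff_gt ht (by omega), zero_mul]
  rw [derivative_mul, map_add, mul_comm (p (n + 1) t) (derivative _), h2, h3,
    S.orth (n + 1) n t ht, if_neg (by omega)] at h1
  linarith

/-- `x` times the `t`-derivative of an orthogonal polynomial. -/
lemma X_mul_deriv (S : IsPertOPS α p h) {t : ℝ} (ht : 0 < t) {n : ℕ} {q : ℝ[X]}
    (hq : HasPolyDerivAt (p (n + 1)) q t) :
    X * q = C (pertFunctional α t 1 (p (n + 1) t * p n t) / h n t) * p (n + 1) t
      - C (pertFunctional α t 1 (p (n + 1) t * p (n + 1) t) / h n t) * p n t := by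
  have hh := (S.norm_pos ht n).ne'
  have hh1 := (S.norm_pos ht (n + 1)).ne'
  have hq0 : ∀ i, n + 1 ≤ i → q.coeff i = 0 := fun i hi => S.deriv_coeff ht hq hi
  have hXq : ∀ i, n + 1 < i → (X * q).coeff i = 0 := by
    intro i hi
    rcases i with _ | i
    · omega
    · rw [coeff_X_mul]
      exact hq0 i (by omega)
  have h1 := S.eq_span_two ht (n := n) hXq fun j hj => by
    have e : p j t * (X * q) = (X * p j t) * q := by ring
    have hc : ∀ i, n + 1 ≤ i → (X * p j t).coeff i = 0 := by
      intro i hi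
      rcases i with _ | i
      · omega
      · rw [coeff_X_mul]
        exact S.coeff_gt ht (by omega)
    rw [e, S.deriv_pairing ht hq hc, mul_assoc, pertFunctional.succ_X_mul α t 0,
      S.orth j (n + 1) t ht, if_neg (by omega)]
  have h2 : pertFunctional α t 0 (p (n + 1) t * (X * q)) / h (n + 1) t
      = pertFunctional α t 1 (p (n + 1) t * p n t) / h n t := by
    rw [mul_comm (p (n + 1) t) (X * q), S.pairing ht hXq, coeff_X_mul]
    have h3 := S.deriv_pairing ht hq (g := p n t) fun i hi => S.coeff_gt ht (by omega)
    rw [mul_comm (p n t) q, S.pairing ht (fun i hi => hq0 i hi), mul_comm (p n t)] at h3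
    rw [← h3]
    field_simp
  have h4 : pertFunctional α t 0 (p n t * (X * q)) / h n t
      = -(pertFunctional α t 1 (p (n + 1) t * p (n + 1) t) / h n t) := by
    have e : p n t * (X * q) = (X * p n t - p (n + 1) t) * q + q * p (n + 1) t := by ring
    have hc : ∀ i, n + 1 ≤ i → (X * p n t - p (n + 1) t).coeff i = 0 := by
      intro i hi
      rcases i with _ | i
      · omega
      · rw [coeff_sub, coeff_X_mul]
        rcases eq_or_lt_of_le hi with he | hlt
        · obtain rfl : n = i := by omega
          rw [S.coeff_self ht, S.coeff_self ht, sub_self]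
        · rw [S.coeff_gt ht (by omega), S.coeff_gt ht (by omega), sub_self]
    rw [e, map_add, S.pairing_lt ht hq0, S.deriv_pairing ht hq hc, sub_mul, map_sub, mul_assoc,
      pertFunctional.succ_X_mul α t 0, S.orth n (n + 1) t ht, if_neg (by omega)]
    ring
  rw [h2, h4] at h1
  rw [h1]
  simp only [C_neg]
  ring

/-- The scaling identity `x p' + t ṗ = (n+1) p_{n+1} + β p_n`. -/
lemma X_mul_derivative_add (S : IsPertOPS α p h) {t : ℝ} (ht : 0 < t) {n : ℕ} {q : ℝ[X]}
    (hq : HasPolyDerivAt (p (n + 1)) q t) :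
    X * derivative (p (n + 1) t) + C t * q
      = C ((n : ℝ) + 1) * p (n + 1) t + C (h (n + 1) t / h n t) * p n t := by
  have hh := (S.norm_pos ht n).ne'
  have hh1 := (S.norm_pos ht (n + 1)).ne'
  have hq0 : ∀ i, n + 1 ≤ i → q.coeff i = 0 := fun i hi => S.deriv_coeff ht hq hi
  have hc : ∀ i, n + 1 < i →
      (X * derivative (p (n + 1) t) + C t * q).coeff i = 0 := by
    intro i hi
    rcases i with _ | i
    · omega
    · rw [coeff_add, coeff_X_mul, coeff_C_mul, hq0 _ (by omega), coeff_derivative,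
        S.coeff_gt ht (by omega)]
      ring
  have key : ∀ r : ℝ[X], (∀ i, n + 1 ≤ i → r.coeff i = 0) →
      pertFunctional α t 0 (r * (X * derivative (p (n + 1) t) + C t * q))
        = r.coeff n * h (n + 1) t := by
    intro r hr
    have h1 := pertFunctional.by_parts S.alpha_pos ht (X * (r * p (n + 1) t))
    have e : derivative (X * (r * p (n + 1) t))
        = r * p (n + 1) t + X * derivative r * p (n + 1) t
          + r * (X * derivative (p (n + 1) t)) := by
      rw [derivative_mul, derivative_mul, derivative_X]
      ring
    have e2 : pertFunctional α t 2 (X * (r * p (n + 1) t))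
        = pertFunctional α t 1 (r * p (n + 1) t) := pertFunctional.succ_X_mul α t 1 _
    have e1 : pertFunctional α t 1 (X * (r * p (n + 1) t))
        = pertFunctional α t 0 (r * p (n + 1) t) := pertFunctional.succ_X_mul α t 0 _
    have z1 : pertFunctional α t 0 (r * p (n + 1) t) = 0 := S.pairing_lt ht hr
    have z2 : pertFunctional α t 0 (X * derivative r * p (n + 1) t) = 0 := by
      refine S.pairing_lt ht fun i hi => ?_
      rcases i with _ | i
      · omega
      · rw [coeff_X_mul, coeff_derivative, hr _ hi, zero_mul]
    have z3 : pertFunctional α t 0 (X * (r * p (n + 1) t)) = r.coeff n * h (n + 1) t := by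
      rw [← mul_assoc, S.pairing ht, coeff_X_mul]
      intro i hi
      rcases i with _ | i
      · omega
      · rw [coeff_X_mul, hr _ (by omega)]
    have z4 := S.deriv_pairing ht hq hr
    rw [e, e1, e2, map_add, map_add, z1, z2, z3] at h1
    have e3 : r * (X * derivative (p (n + 1) t) + C t * q)
        = r * (X * derivative (p (n + 1) t)) + C t * (r * q) := by ring
    rw [e3, map_add, pertFunctional.map_C_mul, z4]
    linarith
  have h1 := S.eq_span_two ht (n := n) hc fun j hj => by
    rw [key _ fun i hi => S.coeff_gt ht (by omega), S.coeff_gt ht hj, zero_mul]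
  rw [key (p n t) fun i hi => S.coeff_gt ht (by omega), S.coeff_self ht,
    mul_comm (p (n + 1) t), S.pairing ht hc, coeff_add, coeff_X_mul, coeff_C_mul,
    hq0 _ le_rfl, coeff_derivative, S.coeff_self ht] at h1
  rw [h1]
  congr 3
  · field_simp
    ring
  · ring

lemma coeff_norm_relation (S : IsPertOPS α p h) {t : ℝ} (ht : 0 < t) (n : ℕ) :
    t * pertFunctional α t 1 (p (n + 1) t * p n t)
      = (p (n + 1) t).coeff n * h n t + h (n + 1) t := by
  obtain ⟨q, hq⟩ := S.exists_hasPolyDerivAt ht (n + 1)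
  have hh := (S.norm_pos ht n).ne'
  have h1 := congrArg (fun r => r.coeff n) (S.X_mul_derivative_add ht hq)
  have h3 := S.deriv_pairing ht hq (g := p n t) fun i hi => S.coeff_gt ht (by omega)
  rw [mul_comm (p n t) q, S.pairing ht (fun i hi => S.deriv_coeff ht hq hi),
    mul_comm (p n t)] at h3
  have h2 : (X * derivative (p (n + 1) t)).coeff n = n * (p (n + 1) t).coeff n := by
    rcases n with _ | n
    · simp
    · rw [coeff_X_mul, coeff_derivative]
      push_cast
      ring
  simp only [coeff_add, coeff_C_mul, h2, S.coeff_self ht] at h1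
  rw [← h3]
  field_simp at h1
  linarith

lemma hasDerivAt_coeff (S : IsPertOPS α p h) {t : ℝ} (ht : 0 < t) (n : ℕ) :
    HasDerivAt (fun τ => (p (n + 1) τ).coeff n)
      (pertFunctional α t 1 (p (n + 1) t * p n t) / h n t) t := by
  obtain ⟨q, hq⟩ := S.exists_hasPolyDerivAt ht (n + 1)
  have hh := (S.norm_pos ht n).ne'
  have h3 := S.deriv_pairing ht hq (g := p n t) fun i hi => S.coeff_gt ht (by omega)
  rw [mul_comm (p n t) q, S.pairing ht (fun i hi => S.deriv_coeff ht hq hi),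
    mul_comm (p n t)] at h3
  rw [← h3, mul_div_cancel_right₀ _ hh]
  exact hq.2 n

lemma functional_one_mul (S : IsPertOPS α p h) {t : ℝ} (ht : 0 < t) (n : ℕ) :
    pertFunctional α t 1 (p (n + 1) t * p (n + 1) t) * pertFunctional α t 1 (p n t * p n t)
      = pertFunctional α t 1 (p (n + 1) t * p n t) ^ 2
        - pertFunctional α t 1 (p (n + 1) t * p n t) * h n t := by
  obtain ⟨q, hq⟩ := S.exists_hasPolyDerivAt ht (n + 1)
  have hh := (S.norm_pos ht n).ne'
  have h3 := S.deriv_pairing ht hq (g := p n t) fun i hi => S.coeff_gt ht (by omega)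
  have h1 := congrArg (fun r => pertFunctional α t 1 (r * p n t)) (S.X_mul_deriv ht hq)
  simp only [sub_mul, map_sub, mul_assoc, pertFunctional.map_C_mul,
    pertFunctional.succ_X_mul α t 0] at h1
  rw [mul_comm q, h3, mul_comm (p n t) (p (n + 1) t)] at h1
  field_simp at h1
  linarith

lemma functional_one_add (S : IsPertOPS α p h) {t : ℝ} (ht : 0 < t) (n : ℕ) :
    pertFunctional α t 1 (p (n + 1) t * p (n + 1) t) * h n t
        + h (n + 1) t * pertFunctional α t 1 (p n t * p n t)
      = (n + 1) * h n t ^ 2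
        - (2 * (n + 1) + α) * (pertFunctional α t 1 (p (n + 1) t * p n t) * h n t) := by
  obtain ⟨q, hq⟩ := S.exists_hasPolyDerivAt ht (n + 1)
  have hh := (S.norm_pos ht n).ne'
  have h1 := congrArg (fun r => pertFunctional α t 1 (r * p n t)) (S.X_mul_derivative_add ht hq)
  have h2 := congrArg (fun r => pertFunctional α t 2 (r * p n t)) (S.X_mul_deriv ht hq)
  have h3 : pertFunctional α t 0 (derivative (p (n + 1) t) * p n t) = (n + 1) * h n t := by
    rw [S.pairing ht]
    · rw [coeff_derivative, S.coeff_self ht]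
      ring
    · intro i hi
      rw [coeff_derivative, S.coeff_gt ht (by omega), zero_mul]
  simp only [add_mul, sub_mul, map_sub, map_add, mul_assoc, pertFunctional.map_C_mul,
    pertFunctional.succ_X_mul α t 0, pertFunctional.succ_X_mul α t 1, h3] at h1 h2
  have h4 := S.functional_two_cross ht n
  have h5 := S.functional_two ht n
  have h6 := S.functional_one_mul ht n
  set A := pertFunctional α t 1 (p (n + 1) t * p (n + 1) t)
  set A' := pertFunctional α t 1 (p n t * p n t)
  set J := pertFunctional α t 1 (p (n + 1) t * p n t)
  set Q := pertFunctional α t 2 (p (n + 1) t * p n t)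
  set Q' := pertFunctional α t 2 (p n t * p n t)
  rw [h2] at h1
  field_simp at h1
  linear_combination (-1) * h1 + J * h4 - A * h5 + α * h6

lemma hasDerivAt_functional_one (S : IsPertOPS α p h) {t : ℝ} (ht : 0 < t) (n : ℕ) :
    HasDerivAt (fun τ => pertFunctional α τ 1 (p (n + 1) τ * p (n + 1) τ))
      (2 * (pertFunctional α t 1 (p (n + 1) t * p n t) / h n t
          * pertFunctional α t 2 (p (n + 1) t * p (n + 1) t)
        - pertFunctional α t 1 (p (n + 1) t * p (n + 1) t) / h n t
          * pertFunctional α t 2 (p (n + 1) t * p n t))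
        - pertFunctional α t 2 (p (n + 1) t * p (n + 1) t)) t := by
  obtain ⟨q, hq⟩ := S.exists_hasPolyDerivAt ht (n + 1)
  refine ((hq.mul hq).functional (α := α) ht 1).congr_deriv ?_
  have h2 := congrArg (fun r => pertFunctional α t 2 (r * p (n + 1) t)) (S.X_mul_deriv ht hq)
  simp only [sub_mul, map_sub, mul_assoc, pertFunctional.map_C_mul,
    pertFunctional.succ_X_mul α t 1] at h2
  rw [map_add, mul_comm (p (n + 1) t) q, h2, mul_comm (p n t) (p (n + 1) t)]
  ring

end IsPertOPS

namespace IsPertOPS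

open Polynomial

variable {α : ℝ} {p : ℕ → ℝ → ℝ[X]} {h : ℕ → ℝ → ℝ}

/-- Minus the logarithmic derivative `-t (log h)'` of the norm. -/
noncomputable def logDeriv (α : ℝ) (p : ℕ → ℝ → ℝ[X]) (h : ℕ → ℝ → ℝ) (n : ℕ) (t : ℝ) : ℝ :=
  t * pertFunctional α t 1 (p n t * p n t) / h n t

/-- The mixed moment of two consecutive orthogonal polynomials. -/
noncomputable def cross (α : ℝ) (p : ℕ → ℝ → ℝ[X]) (h : ℕ → ℝ → ℝ) (n : ℕ) (t : ℝ) : ℝ :=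
  t * pertFunctional α t 1 (p (n + 1) t * p n t) / h n t

lemma logDeriv_pos (S : IsPertOPS α p h) {t : ℝ} (ht : 0 < t) (n : ℕ) :
    0 < logDeriv α p h n t :=
  div_pos (mul_pos ht (pertFunctional.sq_pos ht 1 (S.ne_zero ht n))) (S.norm_pos ht n)

lemma hasDerivAt_norm_eq (S : IsPertOPS α p h) {t : ℝ} (ht : 0 < t) (n : ℕ) :
    HasDerivAt (h n) (-(h n t * logDeriv α p h n t / t)) t := by
  refine (S.hasDerivAt_norm ht n).congr_deriv ?_
  have := (S.norm_pos ht n).ne'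
  rw [logDeriv]
  field_simp

lemma logDeriv_le (S : IsPertOPS α p h) {t : ℝ} (ht : 0 < t) (n : ℕ) :
    logDeriv α p h n t ^ 2 + α * logDeriv α p h n t ≤ t := by
  have h1 := S.functional_two ht n
  have hh := S.norm_pos ht n
  have h2 := S.norm_eq ht n
  set A := pertFunctional α t 1 (p n t * p n t) with hA
  have h3 := pertFunctional.sq_nonneg (α := α) ht 2 ((1 - C (A / h n t) * X) * p n t)
  have e : (1 - C (A / h n t) * X) * p n t * ((1 - C (A / h n t) * X) * p n t)
      = p n t * p n t - C (2 * (A / h n t)) * (X * (p n t * p n t))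
        + C ((A / h n t) ^ 2) * (X * (X * (p n t * p n t))) := by
    simp only [C_mul, C_pow, map_ofNat]
    ring
  rw [e, map_add, map_sub, pertFunctional.map_C_mul, pertFunctional.map_C_mul,
    pertFunctional.succ_X_mul α t 1, pertFunctional.succ_X_mul α t 1,
    pertFunctional.succ_X_mul α t 0, h2, ← hA] at h3
  have h4 : t * (A / h n t) * (t * A / h n t) * (h n t) = t * (A ^ 2 / h n t) * t := by
    field_simp
  have h5 : (A / h n t) ^ 2 * h n t = A * (A / h n t) := by field_simp
  have h6 := mul_nonneg ht.le h3
  have h7 : A = A / h n t * h n t := by field_simp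
  have e2 : logDeriv α p h n t = t * (A / h n t) := by
    rw [logDeriv, mul_div_assoc]
  rw [e2]
  set c := A / h n t
  rw [h7] at h1 h6
  have h8 : 0 ≤ t * (1 - α * c - t * c ^ 2) := by
    have : 0 ≤ (1 - α * c - t * c ^ 2) * h n t := by nlinarith
    exact mul_nonneg ht.le (nonneg_of_mul_nonneg_left this hh)
  nlinarith

lemma le_logDeriv (S : IsPertOPS α p h) {t : ℝ} (ht : 0 < t) (n : ℕ) :
    t ≤ logDeriv α p h n t ^ 2 + (2 * n + 1 + α) * logDeriv α p h n t := by
  have h1 := S.functional_X ht n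
  have hh := S.norm_pos ht n
  have h2 := S.norm_eq ht n
  have hA0 : 0 < pertFunctional α t 1 (p n t * p n t) :=
    pertFunctional.sq_pos ht 1 (S.ne_zero ht n)
  rw [logDeriv]
  set A := pertFunctional α t 1 (p n t * p n t) with hA
  have h3 := pertFunctional.sq_nonneg (α := α) ht 1 ((C A * X - C (h n t)) * p n t)
  have e : (C A * X - C (h n t)) * p n t * ((C A * X - C (h n t)) * p n t)
      = C (A ^ 2) * (X * (X * (p n t * p n t))) - C (2 * A * h n t) * (X * (p n t * p n t))
        + C (h n t ^ 2) * (p n t * p n t) := by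
    simp only [C_mul, C_pow, map_ofNat]
    ring
  rw [e, map_add, map_sub, pertFunctional.map_C_mul, pertFunctional.map_C_mul,
    pertFunctional.map_C_mul, pertFunctional.succ_X_mul α t 0, pertFunctional.succ_X_mul α t 0,
    h2, h1, ← hA] at h3
  have h4 : 0 ≤ A * ((2 * n + 1 + α) * h n t) + t * A ^ 2 - h n t ^ 2 := by
    have : 0 ≤ A * (A * ((2 * n + 1 + α) * h n t) + t * A ^ 2 - h n t ^ 2) := by nlinarith
    exact nonneg_of_mul_nonneg_right this hA0
  have h5 : (t * A / h n t) ^ 2 + (2 * n + 1 + α) * (t * A / h n t) - t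
      = t * (A * ((2 * n + 1 + α) * h n t) + t * A ^ 2 - h n t ^ 2) / h n t ^ 2 := by
    field_simp
    ring
  have h6 : 0 ≤ t * (A * ((2 * n + 1 + α) * h n t) + t * A ^ 2 - h n t ^ 2) / h n t ^ 2 := by
    positivity
  linarith

lemma hasDerivAt_logDeriv (S : IsPertOPS α p h) {t : ℝ} (ht : 0 < t) (n : ℕ) :
    HasDerivAt (logDeriv α p h (n + 1))
      (((2 * (n + 1) + 1 + α) * logDeriv α p h (n + 1) t + logDeriv α p h (n + 1) t ^ 2
        + 2 * cross α p h n t - t) / t) t := by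
  have hh := (S.norm_pos ht n).ne'
  have hh1 := (S.norm_pos ht (n + 1)).ne'
  refine (((hasDerivAt_id t).mul (S.hasDerivAt_functional_one ht n)).div
    (S.hasDerivAt_norm ht (n + 1)) hh1).congr_deriv ?_
  have h1 := S.functional_two ht (n + 1)
  have h2 := S.functional_two_cross ht n
  simp only [logDeriv, cross, id]
  set A := pertFunctional α t 1 (p (n + 1) t * p (n + 1) t)
  set J := pertFunctional α t 1 (p (n + 1) t * p n t)
  set Q := pertFunctional α t 2 (p (n + 1) t * p n t)
  set R := pertFunctional α t 2 (p (n + 1) t * p (n + 1) t)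
  have e1 : R = (h (n + 1) t - α * A) / t := by
    field_simp; linarith
  have e2 : Q = -((n + 1) * h n t + α * J) / t := by
    field_simp; linarith
  rw [e1, e2]
  field_simp
  simp only [Pi.mul_apply, id]
  ring

lemma mul_logDeriv (S : IsPertOPS α p h) {t : ℝ} (ht : 0 < t) (n : ℕ) :
    h (n + 1) t / h n t * (logDeriv α p h (n + 1) t * logDeriv α p h n t)
      = cross α p h n t ^ 2 - t * cross α p h n t := by
  have hh := (S.norm_pos ht n).ne'
  have hh1 := (S.norm_pos ht (n + 1)).ne'
  have h1 := S.functional_one_mul ht n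
  simp only [logDeriv, cross]
  field_simp
  linear_combination h1

lemma mul_logDeriv_add (S : IsPertOPS α p h) {t : ℝ} (ht : 0 < t) (n : ℕ) :
    h (n + 1) t / h n t * (logDeriv α p h (n + 1) t + logDeriv α p h n t)
      = (n + 1) * t - (2 * (n + 1) + α) * cross α p h n t := by
  have hh := (S.norm_pos ht n).ne'
  have hh1 := (S.norm_pos ht (n + 1)).ne'
  have h1 := S.functional_one_add ht n
  simp only [logDeriv, cross]
  field_simp
  linear_combination h1

lemma ratio_eq (S : IsPertOPS α p h) {t : ℝ} (ht : 0 < t) (n : ℕ) :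
    h (n + 1) t / h n t = cross α p h n t - (p (n + 1) t).coeff n := by
  have hh := (S.norm_pos ht n).ne'
  have h1 := S.coeff_norm_relation ht n
  rw [cross, h1]
  field_simp
  ring

lemma hasDerivAt_cross (S : IsPertOPS α p h) {t : ℝ} (ht : 0 < t) (n : ℕ) :
    HasDerivAt (cross α p h n)
      (((2 * (n + 1) + 1 + α) * cross α p h n t - (n + 1) * t
        + 2 * cross α p h n t * (cross α p h n t - t) / logDeriv α p h (n + 1) t) / t) t := by
  have hh := (S.norm_pos ht n).ne'
  have hh1 := (S.norm_pos ht (n + 1)).ne'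
  have ha := (S.logDeriv_pos ht (n + 1)).ne'
  have h0 : cross α p h n =ᶠ[𝓝 t] fun τ => (p (n + 1) τ).coeff n + h (n + 1) τ / h n τ := by
    filter_upwards [lt_mem_nhds ht] with τ hτ
    rw [S.ratio_eq hτ]
    ring
  refine (((S.hasDerivAt_coeff ht n).add ((S.hasDerivAt_norm_eq ht (n + 1)).div
    (S.hasDerivAt_norm_eq ht n) hh)).congr_of_eventuallyEq h0).congr_deriv ?_
  have h1 := S.mul_logDeriv ht n
  have h2 := S.mul_logDeriv_add ht n
  have e1 : pertFunctional α t 1 (p (n + 1) t * p n t) / h n t = cross α p h n t / t := by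
    rw [cross]
    field_simp
  rw [e1]
  set a := logDeriv α p h (n + 1) t
  set a' := logDeriv α p h n t
  set b := cross α p h n t
  have e2 : (-(h (n + 1) t * a / t) * h n t - h (n + 1) t * -(h n t * a' / t)) / h n t ^ 2
      = h (n + 1) t / h n t * (a' - a) / t := by
    field_simp
    ring
  rw [e2]
  set β := h (n + 1) t / h n t
  have e3 : β * a' = (b ^ 2 - t * b) / a := by
    field_simp
    linarith
  have e4 : β * a = (n + 1) * t - (2 * (n + 1) + α) * b - (b ^ 2 - t * b) / a := by
    rw [← e3]
    linarith
  rw [mul_sub, e3, e4]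
  field_simp
  ring

lemma coeff_eq_sum (S : IsPertOPS α p h) {t : ℝ} (ht : 0 < t) (n : ℕ) :
    -(p (n + 1) t).coeff n
      = (n + 1) * (n + 1 + α) + ∑ j ∈ Finset.range (n + 1), logDeriv α p h j t := by
  have key : ∀ m : ℕ, (X * p m t).coeff m - (p (m + 1) t).coeff m
      = 2 * m + 1 + α + logDeriv α p h m t := by
    intro m
    have hh := (S.norm_pos ht m).ne'
    have h1 : pertFunctional α t 0 ((X * p m t - p (m + 1) t) * p m t)
        = (X * p m t - p (m + 1) t).coeff m * h m t := by
      refine S.pairing ht fun i hi => ?_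
      rcases i with _ | i
      · omega
      · rw [coeff_sub, coeff_X_mul]
        rcases eq_or_lt_of_le (Nat.le_of_lt_succ hi) with he | hlt
        · rw [← he, S.coeff_self ht, S.coeff_self ht, sub_self]
        · rw [S.coeff_gt ht (by omega), S.coeff_gt ht (by omega), sub_self]
    rw [sub_mul, map_sub, mul_assoc, S.functional_X ht, S.orth (m + 1) m t ht,
      if_neg (by omega), coeff_sub] at h1
    rw [logDeriv]
    field_simp
    linarith
  induction n with
  | zero =>
    have := key 0
    simp at this ⊢
    linarith
  | succ n ih =>
    have := key (n + 1)
    rw [coeff_X_mul] at this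
    rw [Finset.sum_range_succ]
    push_cast at this ⊢
    linarith

lemma tendsto_logDeriv (S : IsPertOPS α p h) (n : ℕ) :
    Tendsto (logDeriv α p h n) (𝓝[>] 0) (𝓝 0) := by
  have hα := S.alpha_pos
  have h1 : Tendsto (fun t : ℝ => t / α) (𝓝[>] 0) (𝓝 0) := by
    have : ContinuousAt (fun t : ℝ => t / α) 0 := by fun_prop
    simpa [ContinuousAt] using this.tendsto.mono_left (nhdsWithin_le_nhds (s := Ioi 0))
  refine squeeze_zero' ?_ ?_ h1
  · filter_upwards [self_mem_nhdsWithin] with t ht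
    exact (S.logDeriv_pos ht n).le
  · filter_upwards [self_mem_nhdsWithin] with t ht
    rw [le_div_iff₀ hα]
    nlinarith [S.logDeriv_le ht n, sq_nonneg (logDeriv α p h n t)]

lemma tendsto_cross (S : IsPertOPS α p h) (n : ℕ) :
    Tendsto (cross α p h n) (𝓝[>] 0) (𝓝 0) := by
  have hα := S.alpha_pos
  have hid : Tendsto (fun t : ℝ => t) (𝓝[>] 0) (𝓝 0) :=
    tendsto_id.mono_left nhdsWithin_le_nhds
  have hsum : Tendsto (fun t => ∑ j ∈ Finset.range (n + 1), logDeriv α p h j t) (𝓝[>] 0)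
      (𝓝 0) := by
    simpa using tendsto_finsetSum (Finset.range (n + 1)) fun j _ => S.tendsto_logDeriv j
  have hlow : Tendsto (fun t => -(((n + 1) * (n + 1 + α) + t
      + ∑ j ∈ Finset.range (n + 1), logDeriv α p h j t)
      * (logDeriv α p h (n + 1) t + logDeriv α p h n t))) (𝓝[>] 0) (𝓝 0) := by
    simpa using ((((tendsto_const_nhds (x := ((n : ℝ) + 1) * (n + 1 + α))).add hid).add
      hsum).mul ((S.tendsto_logDeriv (n + 1)).add (S.tendsto_logDeriv n))).neg
  have hbd : ∀ t, 0 < t → cross α p h n t ≤ t := by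
    intro t ht
    have h2 := S.mul_logDeriv_add ht n
    have h3 := S.logDeriv_pos ht n
    have h4 := S.logDeriv_pos ht (n + 1)
    have h5 := div_pos (S.norm_pos ht (n + 1)) (S.norm_pos ht n)
    have h6 : 0 ≤ h (n + 1) t / h n t * (logDeriv α p h (n + 1) t + logDeriv α p h n t) := by
      positivity
    have hn : (0:ℝ) ≤ n := n.cast_nonneg
    by_contra! hlt
    nlinarith
  refine tendsto_of_tendsto_of_tendsto_of_le_of_le' hlow hid ?_ ?_
  · filter_upwards [self_mem_nhdsWithin] with t ht
    have ht : 0 < t := ht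
    have h2 := S.mul_logDeriv_add ht n
    have h3 := S.logDeriv_pos ht n
    have h4 := S.logDeriv_pos ht (n + 1)
    have h5 := S.ratio_eq ht n
    have h6 := S.coeff_eq_sum ht n
    have h7 := hbd t ht
    have hn : (0:ℝ) ≤ n := n.cast_nonneg
    have h8 : h (n + 1) t / h n t * (logDeriv α p h (n + 1) t + logDeriv α p h n t)
      ≤ ((n + 1) * (n + 1 + α) + t + ∑ j ∈ Finset.range (n + 1), logDeriv α p h j t)
        * (logDeriv α p h (n + 1) t + logDeriv α p h n t) :=
      mul_le_mul_of_nonneg_right (by linarith) (by linarith)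
    by_contra! hlt
    have h9 : cross α p h n t < 0 := by
      by_contra! h9
      have : 0 ≤ ((n + 1) * (n + 1 + α) + t + ∑ j ∈ Finset.range (n + 1), logDeriv α p h j t)
        * (logDeriv α p h (n + 1) t + logDeriv α p h n t) := by
        have hs : 0 ≤ ∑ j ∈ Finset.range (n + 1), logDeriv α p h j t :=
          Finset.sum_nonneg fun j _ => (S.logDeriv_pos ht j).le
        exact mul_nonneg (add_nonneg (by positivity) hs) (by linarith)
      linarith
    have h10 : 0 ≤ ((n : ℝ) + 1) * t := by positivity
    have h11 := mul_pos_of_neg_of_neg h9 (show -(2 * (n + 1) + α - 1) < 0 by linarith)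
    linarith
  · filter_upwards [self_mem_nhdsWithin] with t ht
    exact hbd t ht

lemma tendsto_norm (S : IsPertOPS α p h) (n : ℕ) :
    Tendsto (h n) (𝓝[>] 0) (𝓝 (n.factorial * Real.Gamma (n + 1 + α))) := by
  have hα := S.alpha_pos
  induction n with
  | zero =>
    have h1 := tendsto_pertMoment hα
    refine Tendsto.congr' ?_ (by simpa [add_comm] using h1)
    filter_upwards [self_mem_nhdsWithin] with t ht
    have h2 : p 0 t = 1 := by
      have h3 := S.natDegree 0 t ht
      exact (S.monic 0 t ht).natDegree_eq_zero.1 h3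
    rw [← S.norm_eq ht, h2, one_mul, ← pow_zero X, pertFunctional.map_X_pow]
    simp
  | succ n ih =>
    have hsum : Tendsto (fun t => ∑ j ∈ Finset.range (n + 1), logDeriv α p h j t) (𝓝[>] 0)
        (𝓝 0) := by
      simpa using tendsto_finsetSum (Finset.range (n + 1)) fun j _ => S.tendsto_logDeriv j
    have h1 := (((S.tendsto_cross n).add (tendsto_const_nhds
      (x := ((n : ℝ) + 1) * (n + 1 + α)))).add hsum).mul ih
    have e : (((n + 1).factorial : ℕ) : ℝ) * Real.Gamma (((n + 1 : ℕ) : ℝ) + 1 + α)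
        = (0 + ((n : ℝ) + 1) * (n + 1 + α) + 0) * (n.factorial * Real.Gamma (n + 1 + α)) := by
      have : Real.Gamma (((n + 1 : ℕ) : ℝ) + 1 + α) = (n + 1 + α) * Real.Gamma (n + 1 + α) := by
        rw [← Real.Gamma_add_one (by positivity)]
        congr 1
        push_cast
        ring
      rw [this, Nat.factorial_succ]
      push_cast
      ring
    rw [e]
    refine h1.congr' ?_
    filter_upwards [self_mem_nhdsWithin] with t ht
    have hh := (S.norm_pos ht n).ne'
    have h5 := S.ratio_eq ht n
    have h6 := S.coeff_eq_sum ht n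
    rw [div_eq_iff hh] at h5
    rw [h5]
    linear_combination (-(h n t)) * h6

end IsPertOPS

/-- A maximum principle on the line for functions of at most linear growth. -/
lemma nonpos_of_deriv2_ge {δ δ' δ'' : ℝ → ℝ} {c M : ℝ} (hc : 0 < c)
    (h1 : ∀ x, HasDerivAt δ (δ' x) x) (h2 : ∀ x, HasDerivAt δ' (δ'' x) x)
    (hM : ∀ x, δ x ≤ M * (1 + |x|)) (hpos : ∀ x, 0 < δ x → c * δ x ≤ δ'' x) (x : ℝ) :
    δ x ≤ 0 := by
  by_contra! hx
  set m : ℝ := 3 / c with hm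
  have hm0 : 0 < m := by positivity
  obtain ⟨η, hη0, hη⟩ : ∃ η > 0, η * (x ^ 2 + m) < δ x := by
    refine ⟨δ x / (2 * (x ^ 2 + m)), by positivity, ?_⟩
    rw [div_mul_eq_mul_div, div_lt_iff₀ (by positivity)]
    nlinarith [mul_pos hx (show 0 < x ^ 2 + m by positivity)]
  set φ : ℝ → ℝ := fun y => δ y - η * (y ^ 2 + m) with hφ
  have d1 : ∀ y, HasDerivAt φ (δ' y - η * (2 * y)) y := by
    intro y
    have := (h1 y).sub ((((hasDerivAt_id y).pow 2).add_const m).const_mul η)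
    refine this.congr_deriv ?_
    simp
  have d2 : ∀ y, HasDerivAt (fun y => δ' y - η * (2 * y)) (δ'' y - η * 2) y := by
    intro y
    have := (h2 y).sub (((hasDerivAt_id y).const_mul 2).const_mul η)
    refine this.congr_deriv ?_
    simp
  have hcont : Continuous φ := continuous_iff_continuousAt.2 fun y => (d1 y).continuousAt
  have hev : ∀ᶠ y in cocompact ℝ, φ y ≤ φ x := by
    filter_upwards [(tendsto_norm_cocompact_atTop (E := ℝ)).eventually_ge_atTop
      (1 + 2 * |M| / η)] with y hy
    rw [Real.norm_eq_abs] at hy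
    have hy1 : 1 ≤ |y| := by
      have : 0 ≤ 2 * |M| / η := by positivity
      linarith
    have hy2 : 2 * |M| ≤ η * |y| := by
      have : 2 * |M| / η ≤ |y| := by linarith
      rw [div_le_iff₀ hη0] at this
      linarith
    have h3 : δ y ≤ η * y ^ 2 := by
      calc δ y ≤ M * (1 + |y|) := hM y
        _ ≤ |M| * (1 + |y|) := by gcongr; exact le_abs_self M
        _ ≤ 2 * |M| * |y| := by nlinarith [abs_nonneg M]
        _ ≤ η * |y| * |y| := by gcongr
        _ = η * y ^ 2 := by rw [mul_assoc, ← sq, sq_abs]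
    have : φ y ≤ 0 := by
      simp only [hφ]
      nlinarith [mul_pos hη0 hm0]
    have : 0 < φ x := by simp only [hφ]; linarith
    linarith
  obtain ⟨z, hz⟩ := hcont.exists_forall_ge' x hev
  have hz0 : 0 < φ z := lt_of_lt_of_le (by simp only [hφ]; linarith) (hz x)
  have hδz : η * (z ^ 2 + m) < δ z := by simp only [hφ] at hz0; linarith
  have hδz0 : 0 < δ z := lt_trans (by positivity) hδz
  have hder : deriv φ = fun y => δ' y - η * (2 * y) := funext fun y => (d1 y).deriv
  have hsec : 0 < deriv (deriv φ) z := by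
    rw [hder, (d2 z).deriv]
    have h3 := hpos z hδz0
    have h4 : c * (η * (z ^ 2 + m)) < c * δ z := mul_lt_mul_of_pos_left hδz hc
    have h5 : c * (η * (z ^ 2 + m)) = c * η * z ^ 2 + 3 * η := by
      rw [hm]; field_simp
    have : 0 ≤ c * η * z ^ 2 := by positivity
    linarith
  have hmax : IsLocalMax φ z := Eventually.of_forall hz
  have hmin := isLocalMin_of_deriv_deriv_pos hsec hmax.deriv_eq_zero hcont.continuousAt
  have heq : φ =ᶠ[𝓝 z] fun _ => φ z := by
    filter_upwards [hmax, hmin] with y h3 h4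
    exact le_antisymm h3 h4
  have := (heq.deriv.deriv).self_of_nhds
  simp at this
  linarith

/-- The right-hand side of the second-order equation solved by the logarithm of the scaled
logarithmic derivative of the norms. -/
noncomputable def pertForce (α κ x v : ℝ) : ℝ :=
  Real.exp v + κ * Real.exp (2 * v) + α * Real.exp (x - v) - Real.exp (2 * (x - v))

/-- Solutions of the second-order equation with controlled growth. -/
structure IsPertSol (α κ : ℝ) (v w : ℝ → ℝ) : Prop where
  alpha_pos : 0 < α
  kappa_nonneg : 0 ≤ κ
  hasDeriv : ∀ x, HasDerivAt v (w x) x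
  hasDeriv_two : ∀ x, HasDerivAt w (pertForce α κ x (v x)) x
  upper : ∀ x, α ≤ Real.exp (x - v x)
  lower : ∃ M, ∀ x, -(M * (1 + |x|)) ≤ v x

lemma mul_le_of_exp_mul_le {α Y₁ Y₂ δ : ℝ} (hα : 0 < α) (h1 : α ≤ Y₁) (hδ : 0 ≤ δ)
    (h12 : Y₁ * Real.exp δ ≤ Y₂) :
    Y₁ * Y₂ * δ ≤ α * Y₁ - Y₁ ^ 2 - (α * Y₂ - Y₂ ^ 2) := by
  have h3 : δ + 1 ≤ Real.exp δ := Real.add_one_le_exp δ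
  have h4 : Y₁ * (1 + δ) ≤ Y₂ := 
    (mul_le_mul_of_nonneg_left (by linarith) (hα.le.trans h1)).trans h12
  have hY1 : 0 < Y₁ := hα.trans_le h1
  have h5 : Y₁ * δ ≤ Y₂ - Y₁ := by linarith
  have h6 : Y₂ ≤ Y₁ + Y₂ - α := by linarith
  have hY2 : 0 ≤ Y₂ := by nlinarith [mul_nonneg hY1.le hδ]
  calc Y₁ * Y₂ * δ = Y₁ * δ * Y₂ := by ring
    _ ≤ (Y₂ - Y₁) * (Y₁ + Y₂ - α) := by
        refine mul_le_mul h5 h6 hY2 ?_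
        linarith [mul_nonneg hY1.le hδ]
    _ = _ := by ring

lemma sq_mul_le_of_exp_mul_le {α Y₁ Y₂ δ : ℝ} (hα : 0 < α) (h1 : α ≤ Y₁) (h2 : α ≤ Y₂)
    (hδ : 0 ≤ δ) (h12 : Y₁ * Real.exp δ ≤ Y₂) :
    α ^ 2 * δ ≤ α * Y₁ - Y₁ ^ 2 - (α * Y₂ - Y₂ ^ 2) := by
  refine le_trans ?_ (mul_le_of_exp_mul_le hα h1 hδ h12)
  have : α * α ≤ Y₁ * Y₂ := mul_le_mul h1 h2 hα.le (hα.le.trans h1)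
  rw [sq]
  gcongr

lemma pertForce_eq (α κ x v : ℝ) : pertForce α κ x v
    = Real.exp v + κ * Real.exp v ^ 2 + α * Real.exp (x - v) - Real.exp (x - v) ^ 2 := by
  rw [pertForce, two_mul, two_mul, Real.exp_add, Real.exp_add, sq, sq]

namespace IsPertSol

variable {α κ κ₁ κ₂ : ℝ} {v w v₁ w₁ v₂ w₂ : ℝ → ℝ}

lemma exists_le (S : IsPertSol α κ v w) : ∃ M, ∀ x, v x ≤ M * (1 + |x|) := by
  refine ⟨1 + |Real.log α|, fun x => ?_⟩
  have h1 := Real.log_le_log S.alpha_pos (S.upper x)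
  rw [Real.log_exp] at h1
  nlinarith [neg_abs_le (Real.log α), le_abs_self x, abs_nonneg x, abs_nonneg (Real.log α)]

lemma exists_sub_le (S₁ : IsPertSol α κ₁ v₁ w₁) (S₂ : IsPertSol α κ₂ v₂ w₂) :
    ∃ M, ∀ x, v₁ x - v₂ x ≤ M * (1 + |x|) := by
  obtain ⟨M₁, h1⟩ := S₁.exists_le
  obtain ⟨M₂, h2⟩ := S₂.lower
  exact ⟨M₁ + M₂, fun x => by linarith [h1 x, h2 x]⟩

lemma mono (S₁ : IsPertSol α κ₁ v₁ w₁) (S₂ : IsPertSol α κ₂ v₂ w₂) (hκ : κ₂ ≤ κ₁) (x : ℝ) :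
    v₁ x ≤ v₂ x := by
  obtain ⟨M, hM⟩ := S₁.exists_sub_le S₂
  rw [← sub_nonpos]
  refine nonpos_of_deriv2_ge (δ := fun x => v₁ x - v₂ x) (sq_pos_of_pos S₁.alpha_pos)
    (fun x => (S₁.hasDeriv x).sub (S₂.hasDeriv x))
    (fun x => (S₁.hasDeriv_two x).sub (S₂.hasDeriv_two x))
    hM (fun x hx => ?_) x
  have h1 := sq_mul_le_of_exp_mul_le S₁.alpha_pos (S₁.upper x) (S₂.upper x) hx.le
    (by rw [← Real.exp_add]; gcongr; linarith)
  have h2 : Real.exp (v₂ x) ≤ Real.exp (v₁ x) := by gcongr; linarith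
  have h3 : κ₂ * Real.exp (v₂ x) ^ 2 ≤ κ₁ * Real.exp (v₁ x) ^ 2 := by
    gcongr
    exact S₁.kappa_nonneg
  rw [pertForce_eq, pertForce_eq]
  linarith

lemma le_translate (S : IsPertSol α κ v w) {l : ℝ} (hl : 0 ≤ l) (x : ℝ) : v x ≤ v (x + l) := by
  obtain ⟨M₁, h1⟩ := S.exists_le
  obtain ⟨M₂, h2⟩ := S.lower
  rw [← sub_nonpos]
  refine nonpos_of_deriv2_ge (δ := fun x => v x - v (x + l)) (sq_pos_of_pos S.alpha_pos)
    (M := |M₁| + |M₂| * (1 + l))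
    (fun x => (S.hasDeriv x).sub ((S.hasDeriv (x + l)).comp_add_const x l))
    (fun x => (S.hasDeriv_two x).sub ((S.hasDeriv_two (x + l)).comp_add_const x l))
    (fun x => ?_) (fun x hx => ?_) x
  · have h3 : v x ≤ |M₁| * (1 + |x|) :=
      (h1 x).trans (by gcongr; exact le_abs_self _)
    have h4 : M₂ * (1 + |x + l|) ≤ |M₂| * (1 + (|x| + l)) := by
      have := abs_add_le x l
      rw [abs_of_nonneg hl] at this
      exact mul_le_mul (le_abs_self _) (by linarith) (by positivity) (abs_nonneg _)
    have h5 : |M₂| * (1 + (|x| + l)) ≤ |M₂| * ((1 + l) * (1 + |x|)) := by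
      gcongr
      nlinarith [abs_nonneg x]
    linarith [h2 (x + l)]
  · have h3 := sq_mul_le_of_exp_mul_le S.alpha_pos (S.upper x) (S.upper (x + l)) hx.le
      (by rw [← Real.exp_add]; gcongr; linarith)
    have h4 : Real.exp (v (x + l)) ≤ Real.exp (v x) := by gcongr; linarith
    have h5 : κ * Real.exp (v (x + l)) ^ 2 ≤ κ * Real.exp (v x) ^ 2 := by
      gcongr
      exact S.kappa_nonneg
    rw [pertForce_eq, pertForce_eq]
    linarith

lemma translate_le (S : IsPertSol α κ v w) {l : ℝ} (hl : 0 ≤ l) (x : ℝ) :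
    v (x + l) ≤ v x + l := by
  obtain ⟨M₁, h1⟩ := S.exists_le
  obtain ⟨M₂, h2⟩ := S.lower
  have := nonpos_of_deriv2_ge (δ := fun x => v (x + l) - v x - l) (sq_pos_of_pos S.alpha_pos)
    (M := |M₂| + |M₁| * (1 + l))
    (fun x => (((S.hasDeriv (x + l)).comp_add_const x l).sub (S.hasDeriv x)).sub_const l)
    (fun x => ((S.hasDeriv_two (x + l)).comp_add_const x l).sub (S.hasDeriv_two x))
    (fun x => ?_) (fun x hx => ?_) x
  · linarith
  · have h3 : -v x ≤ |M₂| * (1 + |x|) :=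
      le_trans (by linarith [h2 x]) (show M₂ * (1 + |x|) ≤ _ by gcongr; exact le_abs_self _)
    have h4 : M₁ * (1 + |x + l|) ≤ |M₁| * (1 + (|x| + l)) := by
      have := abs_add_le x l
      rw [abs_of_nonneg hl] at this
      exact mul_le_mul (le_abs_self _) (by linarith) (by positivity) (abs_nonneg _)
    have h5 : |M₁| * (1 + (|x| + l)) ≤ |M₁| * ((1 + l) * (1 + |x|)) := by
      gcongr
      nlinarith [abs_nonneg x]
    linarith [h1 (x + l)]
  · have h3 := sq_mul_le_of_exp_mul_le S.alpha_pos (S.upper (x + l)) (S.upper x) hx.le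
      (by rw [← Real.exp_add]; gcongr; linarith)
    have h4 : Real.exp (v x) ≤ Real.exp (v (x + l)) := by gcongr; linarith
    have h5 : κ * Real.exp (v x) ^ 2 ≤ κ * Real.exp (v (x + l)) ^ 2 := by
      gcongr
      exact S.kappa_nonneg
    rw [pertForce_eq, pertForce_eq]
    linarith

lemma monotone (S : IsPertSol α κ v w) : Monotone v := fun x y hxy => by
  simpa using S.le_translate (sub_nonneg.2 hxy) x

lemma antitone_sub (S : IsPertSol α κ v w) : Antitone fun x => v x - x := fun x y hxy => by
  have := S.translate_le (sub_nonneg.2 hxy) x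
  rw [add_sub_cancel] at this
  simp only
  linarith

lemma deriv_nonneg (S : IsPertSol α κ v w) (x : ℝ) : 0 ≤ w x := by
  rw [← (S.hasDeriv x).deriv]
  exact S.monotone.deriv_nonneg

lemma deriv_le_one (S : IsPertSol α κ v w) (x : ℝ) : w x ≤ 1 := by
  have h1 := ((S.hasDeriv x).sub (hasDerivAt_id x)).deriv
  have h2 : deriv (fun x => v x - x) x ≤ 0 := S.antitone_sub.deriv_nonpos
  have h3 : (v - id) = fun x => v x - x := rfl
  rw [h3] at h1
  linarith

/-- The solutions stay below `s^{2/3}` in the variable `s = e^x`. -/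
lemma le_two_thirds (S : IsPertSol α κ v w) (x : ℝ) : v x ≤ 2 * x / 3 := by
  obtain ⟨M, hM⟩ := S.exists_le
  rw [← sub_nonpos]
  refine nonpos_of_deriv2_ge (δ := fun x => v x - 2 * x / 3) (sq_pos_of_pos S.alpha_pos)
    (δ' := fun x => w x - 2 / 3) (M := M + 1)
    (fun x => ?_) (fun x => (S.hasDeriv_two x).sub_const _) (fun x => ?_) (fun x hx => ?_) x
  · refine ((S.hasDeriv x).sub (((hasDerivAt_id x).const_mul 2).div_const 3)).congr_deriv ?_
    simp
  · have := hM x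
    have := neg_abs_le x
    linarith [abs_nonneg x]
  · rw [pertForce_eq]
    set δ := v x - 2 * x / 3
    have hα := S.alpha_pos
    have hZ : 0 < Real.exp (x / 3) := Real.exp_pos _
    have e1 : Real.exp (v x) = Real.exp (x / 3) ^ 2 * Real.exp δ := by
      rw [sq, ← Real.exp_add, ← Real.exp_add]
      congr 1
      ring
    have e2 : Real.exp (x - v x) = Real.exp (x / 3) * Real.exp (-δ) := by
      rw [← Real.exp_add]
      congr 1
      ring
    have h1 := S.upper x
    have h2 : Real.exp (-δ) ≤ 1 := Real.exp_le_one_iff.2 (by linarith)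
    have h3 := Real.add_one_le_exp δ
    have h4 : α ≤ Real.exp (x / 3) := by
      rw [e2] at h1
      nlinarith
    have h5 : 0 ≤ κ * Real.exp (v x) ^ 2 := mul_nonneg S.kappa_nonneg (by positivity)
    have h6 : 0 ≤ α * Real.exp (x - v x) := by positivity
    have h7 : Real.exp (x - v x) ^ 2 ≤ Real.exp (x / 3) ^ 2 := by
      rw [e2]
      gcongr
      nlinarith
    have h8 : α ^ 2 * δ ≤ Real.exp (x / 3) ^ 2 * δ := by gcongr
    rw [e1] at h5 ⊢
    nlinarith [mul_le_mul_of_nonneg_left h3 (sq_nonneg (Real.exp (x / 3)))]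

lemma exp_third_le (S : IsPertSol α κ v w) (x : ℝ) : Real.exp (x / 3) ≤ Real.exp (x - v x) := by
  gcongr
  linarith [S.le_two_thirds x]

lemma sub_le (S₁ : IsPertSol α κ₁ v₁ w₁) (S₂ : IsPertSol α κ₂ v₂ w₂) (x : ℝ) :
    v₂ x - v₁ x ≤ κ₁ * (1 + Real.exp (2 * x / 3)) := by
  obtain ⟨M, hM⟩ := S₂.exists_sub_le S₁
  rw [← sub_nonpos]
  have hE : ∀ x, HasDerivAt (fun x : ℝ => Real.exp (2 * x / 3))
      (2 / 3 * Real.exp (2 * x / 3)) x := by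
    intro x
    refine (((hasDerivAt_id x).const_mul 2).div_const 3).exp.congr_deriv ?_
    simp
    ring
  have hκ1 := S₁.kappa_nonneg
  refine nonpos_of_deriv2_ge (δ := fun x => v₂ x - v₁ x - κ₁ * (1 + Real.exp (2 * x / 3)))
    (sq_pos_of_pos S₁.alpha_pos) (M := M)
    (fun x => ((S₂.hasDeriv x).sub (S₁.hasDeriv x)).sub (((hE x).const_add 1).const_mul κ₁))
    (fun x => ((S₂.hasDeriv_two x).sub (S₁.hasDeriv_two x)).sub
      (((hE x).const_mul (2 / 3)).const_mul κ₁))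
    (fun x => ?_) (fun x hx => ?_) x
  · have := hM x
    have : 0 ≤ κ₁ * (1 + Real.exp (2 * x / 3)) := by positivity
    linarith
  · rw [pertForce_eq, pertForce_eq]
    have hB : 0 ≤ κ₁ * (1 + Real.exp (2 * x / 3)) := by positivity
    have hΔ : 0 ≤ v₂ x - v₁ x := by linarith
    have hα := S₁.alpha_pos
    have h1 := mul_le_of_exp_mul_le hα (S₂.upper x) hΔ
      (Y₂ := Real.exp (x - v₁ x)) (by rw [← Real.exp_add]; gcongr; linarith)
    have hZ : 0 < Real.exp (x / 3) := Real.exp_pos _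
    have e1 : Real.exp (2 * x / 3) = Real.exp (x / 3) ^ 2 := by
      rw [sq, ← Real.exp_add]
      congr 1
      ring
    have h2 : Real.exp (v₁ x) ≤ Real.exp (v₂ x) := by gcongr; linarith
    have h3 : 0 ≤ κ₂ * Real.exp (v₂ x) ^ 2 := mul_nonneg S₂.kappa_nonneg (by positivity)
    have h4 : κ₁ * Real.exp (v₁ x) ^ 2 ≤ κ₁ * (Real.exp (x / 3) ^ 2) ^ 2 := by
      rw [← e1]
      gcongr
      exact S₁.le_two_thirds x
    have h5 : Real.exp (x / 3) * Real.exp (x / 3)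
        ≤ Real.exp (x - v₂ x) * Real.exp (x - v₁ x) :=
      mul_le_mul (S₂.exp_third_le x) (S₁.exp_third_le x) hZ.le (Real.exp_pos _).le
    have h6 : α * α ≤ Real.exp (x - v₂ x) * Real.exp (x - v₁ x) :=
      mul_le_mul (S₂.upper x) (S₁.upper x) hα.le (Real.exp_pos _).le
    rw [e1] at hx ⊢
    set m := Real.exp (x - v₂ x) * Real.exp (x - v₁ x)
    set Z := Real.exp (x / 3)
    have h7 : α ^ 2 * (v₂ x - v₁ x - κ₁ * (1 + Z ^ 2))
        ≤ m * (v₂ x - v₁ x - κ₁ * (1 + Z ^ 2)) := by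
      rw [sq α]
      gcongr
    have h8 : Z * Z * (κ₁ * (1 + Z ^ 2)) ≤ m * (κ₁ * (1 + Z ^ 2)) := by gcongr
    have h9 : 0 ≤ κ₁ * Z ^ 2 := by positivity
    nlinarith

end IsPertSol

lemma continuous_pertForce (α κ : ℝ) {v : ℝ → ℝ} (hv : Continuous v) :
    Continuous fun x => pertForce α κ x (v x) := by
  unfold pertForce
  fun_prop

namespace IsPertSol

variable {α κ : ℝ} {v w : ℝ → ℝ}

lemma continuous (S : IsPertSol α κ v w) : Continuous v :=
  continuous_iff_continuousAt.2 fun x => (S.hasDeriv x).continuousAt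

lemma continuous_deriv (S : IsPertSol α κ v w) : Continuous w :=
  continuous_iff_continuousAt.2 fun x => (S.hasDeriv_two x).continuousAt

/-- Solutions with parameters decreasing to zero converge to a solution with parameter zero. -/
lemma exists_limit {κ : ℕ → ℝ} {v w : ℕ → ℝ → ℝ} (S : ∀ n, IsPertSol α (κ n) (v n) (w n))
    (hanti : Antitone κ) (hκ : Tendsto κ atTop (𝓝 0)) : ∃ V W, IsPertSol α 0 V W := by
  have hmono : ∀ x, Monotone fun n => v n x := fun x m n hmn => (S m).mono (S n) (hanti hmn) x
  choose V hV using fun x => (⟨_, tendsto_atTop_ciSup (hmono x)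
    ⟨2 * x / 3, by rintro _ ⟨n, rfl⟩; exact (S n).le_two_thirds x⟩⟩ :
      ∃ y, Tendsto (fun n => v n x) atTop (𝓝 y))
  obtain ⟨c, -, φ, hφ, hc⟩ := (isCompact_Icc (a := (0:ℝ)) (b := 1)).tendsto_subseq
    (x := fun n => w n 0) fun n => ⟨(S n).deriv_nonneg 0, (S n).deriv_le_one 0⟩
  have hVmono : Monotone V := fun x y hxy =>
    le_of_tendsto_of_tendsto' (hV x) (hV y) fun n => (S n).monotone hxy
  have hVanti : ∀ x y, x ≤ y → V y - y ≤ V x - x := fun x y hxy =>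
    le_of_tendsto_of_tendsto' ((hV y).sub_const y) ((hV x).sub_const x)
      fun n => (S n).antitone_sub hxy
  have hVcont : Continuous V := by
    refine (LipschitzWith.of_dist_le_mul (K := 1) fun x y => ?_).continuous
    rw [Real.dist_eq, Real.dist_eq, NNReal.coe_one, one_mul]
    rcases le_total x y with hxy | hxy
    · have h1 := hVmono hxy
      have h2 := hVanti x y hxy
      rw [abs_of_nonpos (by linarith), abs_of_nonpos (by linarith)]
      linarith
    · have h1 := hVmono hxy
      have h2 := hVanti y x hxy
      rw [abs_of_nonneg (by linarith), abs_of_nonneg (by linarith)]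
      linarith
  have hG : Continuous fun x => pertForce α 0 x (V x) := continuous_pertForce α 0 hVcont
  set W : ℝ → ℝ := fun x => c + ∫ y in (0:ℝ)..x, pertForce α 0 y (V y) with hW
  have hWder : ∀ x, HasDerivAt W (pertForce α 0 x (V x)) x := fun x =>
    (intervalIntegral.integral_hasDerivAt_right (hG.intervalIntegrable _ _)
      (hG.stronglyMeasurableAtFilter _ _) hG.continuousAt).const_add c
  have hWcont : Continuous W := continuous_iff_continuousAt.2 fun x => (hWder x).continuousAt
  have hφt := hφ.tendsto_atTop
  have hw : ∀ x, Tendsto (fun n => w (φ n) x) atTop (𝓝 (W x)) := by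
    intro x
    have e : ∀ n, w n x = w n 0 + ∫ y in (0:ℝ)..x, pertForce α (κ n) y (v n y) := by
      intro n
      rw [intervalIntegral.integral_eq_sub_of_hasDerivAt (f := w n)
        (fun y _ => (S n).hasDeriv_two y)
        ((continuous_pertForce α (κ n) (S n).continuous).intervalIntegrable _ _)]
      ring
    simp only [e]
    refine hc.add (intervalIntegral.tendsto_integral_filter_of_dominated_convergence
      (fun y => Real.exp (2 * y / 3) + κ 0 * Real.exp (2 * y / 3) ^ 2
        + α * Real.exp (y - v 0 y) + Real.exp (y - v 0 y) ^ 2) ?_ ?_ ?_ ?_)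
    · exact Eventually.of_forall fun n =>
        (continuous_pertForce α _ (S (φ n)).continuous).aestronglyMeasurable
    · refine Eventually.of_forall fun n => Eventually.of_forall fun y _ => ?_
      have hα := (S 0).alpha_pos
      have h0 := (S (φ n)).kappa_nonneg
      have h1 : Real.exp (v (φ n) y) ≤ Real.exp (2 * y / 3) := by
        gcongr
        exact (S (φ n)).le_two_thirds y
      have h2 : κ (φ n) * Real.exp (v (φ n) y) ^ 2 ≤ κ 0 * Real.exp (2 * y / 3) ^ 2 := by
        gcongr
        · exact (S 0).kappa_nonneg
        · exact hanti (Nat.zero_le _)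
      have h3 : Real.exp (y - v (φ n) y) ≤ Real.exp (y - v 0 y) := by
        gcongr
        exact hmono y (Nat.zero_le _)
      have h4 : Real.exp (y - v (φ n) y) ^ 2 ≤ Real.exp (y - v 0 y) ^ 2 := by gcongr
      have h5 : α * Real.exp (y - v (φ n) y) ≤ α * Real.exp (y - v 0 y) := by gcongr
      have h6 : 0 ≤ κ (φ n) * Real.exp (v (φ n) y) ^ 2 := by positivity
      have h7 : 0 ≤ α * Real.exp (y - v (φ n) y) := by positivity
      rw [pertForce_eq, Real.norm_eq_abs, abs_le]
      constructor
      · nlinarith [Real.exp_pos (v (φ n) y), Real.exp_pos (2 * y / 3),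
          sq_nonneg (Real.exp (y - v (φ n) y))]
      · nlinarith [sq_nonneg (Real.exp (y - v (φ n) y)), sq_nonneg (Real.exp (y - v 0 y))]
    · refine Continuous.intervalIntegrable ?_ _ _
      have := (S 0).continuous
      fun_prop
    · refine Eventually.of_forall fun y _ => ?_
      have h1 := (hV y).comp hφt
      have h2 := hκ.comp hφt
      have h3 := h1.rexp
      have h4 := (h1.const_sub y).rexp
      simp only [pertForce_eq]
      exact (((h3.add (h2.mul (h3.pow 2))).add (h4.const_mul α)).sub (h4.pow 2))
  have hVW : ∀ x, V x = V 0 + ∫ y in (0:ℝ)..x, W y := by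
    intro x
    have e : ∀ n, v n x = v n 0 + ∫ y in (0:ℝ)..x, w n y := by
      intro n
      rw [intervalIntegral.integral_eq_sub_of_hasDerivAt (f := v n)
        (fun y _ => (S n).hasDeriv y) ((S n).continuous_deriv.intervalIntegrable _ _)]
      ring
    refine tendsto_nhds_unique ((hV x).comp hφt) ?_
    have h1 : Tendsto (fun n => v (φ n) 0 + ∫ y in (0:ℝ)..x, w (φ n) y) atTop
        (𝓝 (V 0 + ∫ y in (0:ℝ)..x, W y)) := by
      refine ((hV 0).comp hφt).add
        (intervalIntegral.tendsto_integral_filter_of_dominated_convergence (fun _ => 1) ?_ ?_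
          (intervalIntegrable_const) ?_)
      · exact Eventually.of_forall fun n => (S (φ n)).continuous_deriv.aestronglyMeasurable
      · refine Eventually.of_forall fun n => Eventually.of_forall fun y _ => ?_
        rw [Real.norm_eq_abs, abs_of_nonneg ((S (φ n)).deriv_nonneg y)]
        exact (S (φ n)).deriv_le_one y
      · exact Eventually.of_forall fun y _ => hw y
    exact h1.congr fun n => (e (φ n)).symm
  refine ⟨V, W, (S 0).alpha_pos, le_rfl, fun x => ?_, hWder, fun x => ?_, ?_⟩
  · have h1 : HasDerivAt (fun x => V 0 + ∫ y in (0:ℝ)..x, W y) (W x) x :=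
      (intervalIntegral.integral_hasDerivAt_right (hWcont.intervalIntegrable _ _)
        (hWcont.stronglyMeasurableAtFilter _ _) hWcont.continuousAt).const_add _
    exact h1.congr_of_eventuallyEq (Eventually.of_forall hVW)
  · exact ge_of_tendsto' ((hV x).const_sub x).rexp fun n => (S n).upper x
  · obtain ⟨M, hM⟩ := (S 0).lower
    exact ⟨M, fun x => (hM x).trans (ge_of_tendsto' (hV x) fun n => hmono x (Nat.zero_le n))⟩

/-- Behaviour at `+∞` of the solution with parameter zero. -/
lemma two_thirds_sub_le (S : IsPertSol α 0 v w) (x : ℝ) :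
    2 * x / 3 - v x ≤ (α + 1) * Real.exp (-(x / 3)) := by
  obtain ⟨M, hM⟩ := S.lower
  have hα := S.alpha_pos
  have hE : ∀ x, HasDerivAt (fun x : ℝ => Real.exp (-(x / 3)))
      (-(1 / 3) * Real.exp (-(x / 3))) x := by
    intro x
    refine ((hasDerivAt_id x).div_const 3).neg.exp.congr_deriv ?_
    simp
    ring
  have hL : ∀ x, HasDerivAt (fun x : ℝ => 2 * x / 3) (2 / 3) x := by
    intro x
    refine (((hasDerivAt_id x).const_mul 2).div_const 3).congr_deriv ?_
    simp
  rw [← sub_nonpos]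
  refine nonpos_of_deriv2_ge
    (δ := fun x => 2 * x / 3 - v x - (α + 1) * Real.exp (-(x / 3)))
    (c := 1 / 2) (M := M + 1) (by norm_num)
    (fun x => ((hL x).sub (S.hasDeriv x)).sub ((hE x).const_mul _))
    (fun x => ((S.hasDeriv_two x).const_sub (2 / 3)).sub
      (((hE x).const_mul (-(1 / 3))).const_mul _))
    (fun x => ?_) (fun x hx => ?_) x
  · have := hM x
    have := le_abs_self x
    have : 0 ≤ (α + 1) * Real.exp (-(x / 3)) := by positivity
    linarith [abs_nonneg x]
  · rw [pertForce_eq]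
    set δ := 2 * x / 3 - v x with hδ
    have hZ : 0 < Real.exp (x / 3) := Real.exp_pos _
    have hE1 : Real.exp (-(x / 3)) = 1 / Real.exp (x / 3) := by
      rw [Real.exp_neg, one_div]
    have e1 : Real.exp (v x) = Real.exp (x / 3) ^ 2 * Real.exp (-δ) := by
      rw [sq, ← Real.exp_add, ← Real.exp_add]
      congr 1
      ring
    have e2 : Real.exp (x - v x) = Real.exp (x / 3) * Real.exp δ := by
      rw [← Real.exp_add]
      congr 1
      ring
    rw [e1, e2, hE1]
    rw [hE1] at hx
    set Z := Real.exp (x / 3)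
    set D := δ - (α + 1) * (1 / Z) with hD
    have hD0 : 0 < D := hx
    have hδD : Z * δ = Z * D + (α + 1) := by
      rw [hD]
      field_simp
      ring
    have hδ0 : 0 < δ := by
      have : 0 < (α + 1) * (1 / Z) := by positivity
      linarith
    have h1 : 1 ≤ Real.exp δ := Real.one_le_exp hδ0.le
    have h2 : δ ^ 2 / 2 ≤ Real.exp δ := by
      have := Real.quadratic_le_exp_of_nonneg hδ0.le
      linarith
    have h3 : Real.exp (-δ) ≤ 1 := Real.exp_le_one_iff.2 (by linarith)
    have h4 := Real.add_one_le_exp δ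
    have h5 : Real.exp δ * Real.exp (-δ) = 1 := by
      rw [← Real.exp_add, add_neg_cancel, Real.exp_zero]
    have h6 : (α + 1) ^ 2 ≤ (Z * δ) ^ 2 := by
      have : 0 < Z * D := by positivity
      gcongr
      linarith
    have h7 : (α + 1) ^ 2 / 2 ≤ Z ^ 2 * Real.exp δ := by
      calc (α + 1) ^ 2 / 2 ≤ Z ^ 2 * (δ ^ 2 / 2) := by linarith [mul_pow Z δ 2]
        _ ≤ _ := by gcongr
    have h8 : Z ^ 2 * δ - α * Z = Z * (Z * D + 1) := by
      linear_combination Z * hδD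
    have h9 : Real.exp δ * (Z ^ 2 * δ - α * Z)
        ≤ (Z * Real.exp δ) ^ 2 - α * (Z * Real.exp δ) - Z ^ 2 * Real.exp (-δ) := by
      have : δ ≤ Real.exp δ - Real.exp (-δ) * Real.exp (-δ) := by nlinarith [Real.exp_pos (-δ)]
      have h10 := mul_le_mul_of_nonneg_left this (show 0 ≤ Z ^ 2 * Real.exp δ by positivity)
      have h11 : Z ^ 2 * Real.exp δ * (Real.exp δ - Real.exp (-δ) * Real.exp (-δ))
          = (Z * Real.exp δ) ^ 2 - Z ^ 2 * Real.exp (-δ) := by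
        linear_combination (-(Z ^ 2 * Real.exp (-δ))) * h5
      linarith
    have h12 : (α + 1) * (1 / Z) / 9 ≤ Real.exp δ * Z := by
      have : (α + 1) / 9 ≤ Z ^ 2 * Real.exp δ := by nlinarith
      calc (α + 1) * (1 / Z) / 9 = (α + 1) / 9 * (1 / Z) := by ring
        _ ≤ Z ^ 2 * Real.exp δ * (1 / Z) := by gcongr
        _ = _ := by field_simp
    have h13 : 1 / 2 * D ≤ Z ^ 2 * Real.exp δ * D := by
      gcongr
      nlinarith
    rw [h8] at h9
    nlinarith

/-- Behaviour at `-∞` of the solution with parameter zero. -/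
lemma exists_sub_log_sub_le (S : IsPertSol α 0 v w) :
    ∃ A > 0, ∃ k > 0, ∀ x, x - Real.log α - v x ≤ A * Real.exp (k * x) := by
  obtain ⟨M, hM⟩ := S.lower
  have hα := S.alpha_pos
  set k : ℝ := min 1 α / 2 with hk
  have hk0 : 0 < k := by positivity
  have hk1 : k ≤ 1 := by
    have := min_le_left 1 α
    linarith
  have hkα : k ^ 2 < α ^ 2 := by
    have := min_le_right 1 α
    gcongr
    linarith
  have hkα' : 0 < α ^ 2 - k ^ 2 := by linarith
  set A : ℝ := max (0 - Real.log α - v 0) (max (1 / k) (1 / (α * (α ^ 2 - k ^ 2)))) with hA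
  have hA1 : 0 - Real.log α - v 0 ≤ A := le_max_left _ _
  have hA2 : 1 / k ≤ A := (le_max_left _ _).trans (le_max_right _ _)
  have hA3 : 1 / (α * (α ^ 2 - k ^ 2)) ≤ A := (le_max_right _ _).trans (le_max_right _ _)
  have hA0 : 0 < A := lt_of_lt_of_le (by positivity) hA2
  refine ⟨A, hA0, k, hk0, fun x => ?_⟩
  have hE : ∀ x, HasDerivAt (fun x : ℝ => Real.exp (k * x)) (k * Real.exp (k * x)) x := by
    intro x
    refine ((hasDerivAt_id x).const_mul k).exp.congr_deriv ?_
    simp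
    ring
  rw [← sub_nonpos]
  refine nonpos_of_deriv2_ge
    (δ := fun x => x - Real.log α - v x - A * Real.exp (k * x))
    (M := M + 1 + |Real.log α|) (sq_pos_of_pos hα)
    (fun x => (((hasDerivAt_id x).sub_const _).sub (S.hasDeriv x)).sub ((hE x).const_mul _))
    (fun x => ((S.hasDeriv_two x).const_sub 1).sub (((hE x).const_mul k).const_mul _))
    (fun x => ?_) (fun x hx => ?_) x
  · have := hM x
    have := le_abs_self x
    have : 0 ≤ A * Real.exp (k * x) := by positivity
    nlinarith [abs_nonneg x, neg_abs_le (Real.log α), abs_nonneg (Real.log α)]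
  · have hx0 : x < 0 := by
      by_contra! hx0
      have h1 : v 0 - 0 ≥ v x - x := S.antitone_sub hx0
      have h1' : v 0 ≤ v x := S.monotone hx0
      have h2 := Real.add_one_le_exp (k * x)
      have h3 : A * (k * x + 1) ≤ A * Real.exp (k * x) := by gcongr
      have h4 : 1 ≤ A * k := by
        rwa [div_le_iff₀ hk0] at hA2
      nlinarith
    rw [pertForce_eq]
    set ω := x - Real.log α - v x with hω
    have hω0 : 0 ≤ ω := by
      have h1 := Real.log_le_log hα (S.upper x)
      rw [Real.log_exp] at h1
      linarith
    have e1 : Real.exp (x - v x) = α * Real.exp ω := by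
      have : x - v x = Real.log α + ω := by ring
      rw [this, Real.exp_add, Real.exp_log hα]
    have h2 := Real.add_one_le_exp ω
    have h3 : α * Real.exp (v x) ≤ Real.exp x := by
      calc α * Real.exp (v x) ≤ Real.exp (x - v x) * Real.exp (v x) := by
            gcongr
            exact S.upper x
        _ = Real.exp x := by rw [← Real.exp_add, sub_add_cancel]
    have h4 : Real.exp x ≤ Real.exp (k * x) := by
      gcongr
      nlinarith
    have h5 : Real.exp (v x) ≤ (α ^ 2 - k ^ 2) * A * Real.exp (k * x) := by
      have h6 : 1 ≤ A * (α * (α ^ 2 - k ^ 2)) := by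
        rwa [div_le_iff₀ (by positivity)] at hA3
      have h7 : Real.exp (k * x) ≤ A * (α * (α ^ 2 - k ^ 2)) * Real.exp (k * x) :=
        le_mul_of_one_le_left (Real.exp_pos _).le h6
      have h8 : α * Real.exp (v x) ≤ α * ((α ^ 2 - k ^ 2) * A * Real.exp (k * x)) := by
        linarith
      exact le_of_mul_le_mul_left h8 hα
    rw [e1]
    have h9 : α ^ 2 * ω ≤ (α * Real.exp ω) ^ 2 - α * (α * Real.exp ω) := by
      have : ω ≤ Real.exp ω * (Real.exp ω - 1) := by nlinarith
      calc α ^ 2 * ω ≤ α ^ 2 * (Real.exp ω * (Real.exp ω - 1)) := by gcongr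
        _ = _ := by ring
    nlinarith

lemma log_le (S : IsPertSol α κ v w) (x : ℝ) : 0 ≤ x - Real.log α - v x := by
  have h1 := Real.log_le_log S.alpha_pos (S.upper x)
  rw [Real.log_exp] at h1
  linarith

lemma tendsto_atBot (S : IsPertSol α 0 v w) :
    Tendsto (fun x => x - v x) atBot (𝓝 (Real.log α)) := by
  obtain ⟨A, hA, k, hk, h⟩ := S.exists_sub_log_sub_le
  have h1 : Tendsto (fun x => Real.log α + A * Real.exp (k * x)) atBot (𝓝 (Real.log α)) := by
    have := (Real.tendsto_exp_atBot.comp (tendsto_id.const_mul_atBot hk)).const_mul A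
    simpa using this.const_add (Real.log α)
  refine tendsto_of_tendsto_of_tendsto_of_le_of_le tendsto_const_nhds h1 (fun x => ?_)
    fun x => ?_
  · simp only
    linarith [S.log_le x]
  · simp only
    linarith [h x]

lemma tendsto_deriv_atBot (S : IsPertSol α 0 v w) : Tendsto w atBot (𝓝 1) := by
  obtain ⟨A, hA, k, hk, h⟩ := S.exists_sub_log_sub_le
  have hα := S.alpha_pos
  have hE : Tendsto (fun x : ℝ => x + 1) atBot atBot :=
    tendsto_atBot_add_const_right _ _ tendsto_id
  have h1 : Tendsto (fun x => 1 - A * Real.exp (k * (x + 1)) - Real.exp (x + 1) / α) atBot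
      (𝓝 1) := by
    have h2 := ((Real.tendsto_exp_atBot.comp (hE.const_mul_atBot hk)).const_mul A).const_sub 1
    have h3 := (Real.tendsto_exp_atBot.comp hE).div_const α
    simpa using h2.sub h3
  refine tendsto_of_tendsto_of_tendsto_of_le_of_le h1 tendsto_const_nhds (fun x => ?_)
    fun x => S.deriv_le_one x
  obtain ⟨ξ, hξ, hξ'⟩ := exists_hasDerivAt_eq_slope v w (lt_add_one x)
    S.continuous.continuousOn fun y _ => S.hasDeriv y
  have h2 : Antitone fun x => w x - Real.exp x / α := by
    have hd : ∀ x, HasDerivAt (fun x => w x - Real.exp x / α)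
        (pertForce α 0 x (v x) - Real.exp x / α) x := fun x =>
      (S.hasDeriv_two x).sub ((Real.hasDerivAt_exp x).div_const α)
    refine antitone_of_deriv_nonpos (fun x => (hd x).differentiableAt) fun x => ?_
    rw [(hd x).deriv, pertForce_eq]
    have h3 : Real.exp (v x) ≤ Real.exp x / α := by
      rw [le_div_iff₀ hα]
      calc Real.exp (v x) * α ≤ Real.exp (v x) * Real.exp (x - v x) := by
            gcongr
            exact S.upper x
        _ = Real.exp x := by rw [← Real.exp_add, add_sub_cancel]
    nlinarith [S.upper x]
  have h3 := h2 hξ.1.le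
  simp only at h3
  have h4 : Real.exp ξ ≤ Real.exp (x + 1) := by
    gcongr
    exact hξ.2.le
  have h5 : Real.exp ξ / α ≤ Real.exp (x + 1) / α := by gcongr
  have h6 := h (x + 1)
  have h7 := S.log_le x
  have h8 : 0 ≤ Real.exp x / α := by positivity
  rw [add_sub_cancel_left, div_one] at hξ'
  simp only
  linarith

end IsPertSol

lemma le_of_tendsto_of_hasDerivAt_nonneg {f f' : ℝ → ℝ} {L t : ℝ} (ht : 0 < t)
    (hf : ∀ τ ∈ Ioc 0 t, HasDerivAt f (f' τ) τ) (hf' : ∀ τ ∈ Ioc 0 t, 0 ≤ f' τ)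
    (hL : Tendsto f (𝓝[>] 0) (𝓝 L)) : L ≤ f t := by
  have hmono : MonotoneOn f (Ioc 0 t) := by
    refine monotoneOn_of_deriv_nonneg (convex_Ioc 0 t)
      (fun τ hτ => (hf τ hτ).continuousAt.continuousWithinAt) (fun τ hτ => ?_) fun τ hτ => ?_
    · exact (hf τ (interior_subset hτ)).differentiableAt.differentiableWithinAt
    · rw [(hf τ (interior_subset hτ)).deriv]
      exact hf' τ (interior_subset hτ)
  refine le_of_tendsto hL ?_
  filter_upwards [Ioc_mem_nhdsGT ht] with τ hτ
  exact hmono hτ ⟨ht, le_rfl⟩ hτ.2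

/-- The solution of the third-order equation built from a solution of the second-order one, in
the logarithmic variable. -/
noncomputable def pertProfile (α : ℝ) (v w : ℝ → ℝ) (x : ℝ) : ℝ :=
  1 / 8 + (Real.exp (x - v x) ^ 2 + 2 * Real.exp (v x) - 2 * α * Real.exp (x - v x)
    - (w x - 1) ^ 2) / 2

namespace IsPertSol

variable {α κ : ℝ} {v w : ℝ → ℝ}

lemma contDiff (S : IsPertSol α 0 v w) (n : ℕ) : ContDiff ℝ n v := by
  have hv : deriv v = w := funext fun x => (S.hasDeriv x).deriv
  have hw : deriv w = fun x => pertForce α 0 x (v x) := funext fun x => (S.hasDeriv_two x).deriv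
  have hvd : Differentiable ℝ v := fun x => (S.hasDeriv x).differentiableAt
  have hwd : Differentiable ℝ w := fun x => (S.hasDeriv_two x).differentiableAt
  induction n with
  | zero =>
    rw [Nat.cast_zero, contDiff_zero]
    exact S.continuous
  | succ n ih =>
    have h1 : ContDiff ℝ n (deriv w) := by
      rw [hw]
      unfold pertForce
      fun_prop
    have h2 : ContDiff ℝ (n + 1) w := contDiff_succ_iff_deriv.2 ⟨hwd, by simp, h1⟩
    push_cast
    refine contDiff_succ_iff_deriv.2 ⟨hvd, by simp, ?_⟩
    rw [hv]
    exact h2.of_le (by exact_mod_cast Nat.le_succ n)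

lemma contDiff_deriv (S : IsPertSol α 0 v w) (n : ℕ) : ContDiff ℝ n w := by
  have hv : deriv v = w := funext fun x => (S.hasDeriv x).deriv
  rw [← hv]
  have h := S.contDiff (n + 1)
  push_cast at h
  exact (contDiff_succ_iff_deriv.1 h).2.2

lemma contDiff_profile (S : IsPertSol α 0 v w) : ContDiff ℝ (⊤ : ℕ∞) (pertProfile α v w) := by
  have hv : ContDiff ℝ (⊤ : ℕ∞) v := contDiff_infty.2 S.contDiff
  have hw : ContDiff ℝ (⊤ : ℕ∞) w := contDiff_infty.2 S.contDiff_deriv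
  unfold pertProfile
  fun_prop

lemma hasDerivAt_profile (S : IsPertSol α 0 v w) (x : ℝ) :
    HasDerivAt (pertProfile α v w) (Real.exp (v x)) x := by
  have h1 := ((hasDerivAt_id x).sub (S.hasDeriv x)).exp
  have h2 := (S.hasDeriv x).exp
  have h3 := ((S.hasDeriv_two x).sub_const 1).pow 2
  have h4 := (((((h1.pow 2).add (h2.const_mul 2)).sub (h1.const_mul (2 * α))).sub h3).div_const
    2).const_add (1 / 8)
  refine h4.congr_deriv ?_
  rw [pertForce_eq]
  simp only [Pi.sub_apply, id]
  push_cast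
  ring

lemma hasDerivAt_profile_log (S : IsPertSol α 0 v w) {s : ℝ} (hs : 0 < s) :
    HasDerivAt (fun s => pertProfile α v w (Real.log s))
      (Real.exp (v (Real.log s) - Real.log s)) s := by
  refine ((S.hasDerivAt_profile _).comp s (Real.hasDerivAt_log hs.ne')).congr_deriv ?_
  rw [Real.exp_sub, Real.exp_log hs, div_eq_mul_inv]

lemma hasDerivAt_exp_log (S : IsPertSol α 0 v w) {s : ℝ} (hs : 0 < s) :
    HasDerivAt (fun s => Real.exp (v (Real.log s) - Real.log s))
      (Real.exp (v (Real.log s) - Real.log s) * ((w (Real.log s) - 1) / s)) s := by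
  have h1 := Real.hasDerivAt_log hs.ne'
  refine (((S.hasDeriv _).comp s h1).sub h1).exp.congr_deriv ?_
  simp only [Function.comp_apply, Pi.sub_apply]
  ring

lemma hasDerivAt_exp_log_mul (S : IsPertSol α 0 v w) {s : ℝ} (hs : 0 < s) :
    HasDerivAt (fun s => Real.exp (v (Real.log s) - Real.log s) * ((w (Real.log s) - 1) / s))
      (Real.exp (v (Real.log s) - Real.log s) * ((w (Real.log s) - 1) ^ 2
        + pertForce α 0 (Real.log s) (v (Real.log s)) - (w (Real.log s) - 1)) / s ^ 2) s := by
  have h1 := Real.hasDerivAt_log hs.ne'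
  have h2 := (((S.hasDeriv_two _).comp s h1).sub_const 1).div (hasDerivAt_id s) hs.ne'
  refine ((S.hasDerivAt_exp_log hs).mul h2).congr_deriv ?_
  simp only [Function.comp_apply, Pi.div_apply, id]
  field_simp
  ring

lemma profile_ode (S : IsPertSol α 0 v w) {r : ℝ → ℝ}
    (hr : r = fun s => pertProfile α v w (Real.log s)) {s : ℝ} (hs : 0 < s) :
    2 * s ^ 2 * deriv r s * deriv (deriv (deriv r)) s
      - s ^ 2 * (deriv (deriv r) s) ^ 2
      + 2 * s * deriv r s * deriv (deriv r) s
      - 4 * s * (deriv r s) ^ 3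
      + (2 * r s - 1 / 4) * (deriv r s) ^ 2 + 1 = 0 := by
  have d1 : ∀ τ > 0, deriv r τ = Real.exp (v (Real.log τ) - Real.log τ) := fun τ hτ => by
    rw [hr]
    exact (S.hasDerivAt_profile_log hτ).deriv
  have d2 : ∀ τ > 0, deriv (deriv r) τ
      = Real.exp (v (Real.log τ) - Real.log τ) * ((w (Real.log τ) - 1) / τ) := fun τ hτ => by
    have : deriv r =ᶠ[𝓝 τ] fun s => Real.exp (v (Real.log s) - Real.log s) := by
      filter_upwards [lt_mem_nhds hτ] with s hs using d1 s hs
    rw [this.deriv_eq]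
    exact (S.hasDerivAt_exp_log hτ).deriv
  have d3 : deriv (deriv (deriv r)) s
      = Real.exp (v (Real.log s) - Real.log s) * ((w (Real.log s) - 1) ^ 2
        + pertForce α 0 (Real.log s) (v (Real.log s)) - (w (Real.log s) - 1)) / s ^ 2 := by
    have : deriv (deriv r) =ᶠ[𝓝 s]
        fun s => Real.exp (v (Real.log s) - Real.log s) * ((w (Real.log s) - 1) / s) := by
      filter_upwards [lt_mem_nhds hs] with s hs using d2 s hs
    rw [this.deriv_eq]
    exact (S.hasDerivAt_exp_log_mul hs).deriv
  rw [d1 s hs, d2 s hs, d3, hr, pertForce_eq]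
  simp only [pertProfile]
  have e1 : Real.exp (v (Real.log s)) = s * Real.exp (v (Real.log s) - Real.log s) := by
    rw [Real.exp_sub, Real.exp_log hs]
    field_simp
  have e2 : Real.exp (v (Real.log s) - Real.log s) * Real.exp (Real.log s - v (Real.log s))
      = 1 := by
    rw [← Real.exp_add]
    simp
  rw [e1]
  set E := Real.exp (v (Real.log s) - Real.log s)
  set Y := Real.exp (Real.log s - v (Real.log s))
  field_simp
  linear_combination 32 * (-(E * Y) - 1) * e2

lemma tendsto_profile_log (S : IsPertSol α 0 v w) :
    Tendsto (fun s => pertProfile α v w (Real.log s)) (𝓝[>] 0) (𝓝 ((1 - 4 * α ^ 2) / 8)) := by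
  have hα := S.alpha_pos
  have h1 : Tendsto (fun x => Real.exp (x - v x)) atBot (𝓝 α) := by
    have := S.tendsto_atBot.rexp
    rwa [Real.exp_log hα] at this
  have h2 : Tendsto (fun x => Real.exp (v x)) atBot (𝓝 0) := by
    have := Real.tendsto_exp_atBot.div h1 hα.ne'
    rw [zero_div] at this
    refine this.congr fun x => ?_
    simp only [Pi.div_apply]
    rw [← Real.exp_sub, sub_sub_cancel]
  have h3 := (S.tendsto_deriv_atBot.sub_const 1).pow 2
  have h4 := (((((h1.pow 2).add (h2.const_mul 2)).sub (h1.const_mul (2 * α))).sub h3).div_const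
    2).const_add (1 / 8)
  have e : 1 / 8 + (α ^ 2 + 2 * 0 - 2 * α * α - (1 - 1) ^ 2) / 2 = (1 - 4 * α ^ 2) / 8 := by
    ring
  rw [e] at h4
  exact h4.comp Real.tendsto_log_nhdsGT_zero

lemma exp_log_div_three {s : ℝ} (hs : 0 < s) :
    Real.exp (Real.log s / 3) = s ^ ((1:ℝ) / 3) := by
  rw [Real.rpow_def_of_pos hs]
  congr 1
  ring

lemma exp_two_mul_log_div_three {s : ℝ} (hs : 0 < s) :
    Real.exp (2 * Real.log s / 3) = s ^ ((2:ℝ) / 3) := by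
  rw [Real.rpow_def_of_pos hs]
  congr 1
  ring

lemma abs_profile_sub_le (S : IsPertSol α 0 v w) {x : ℝ} (hx : α + 1 ≤ Real.exp (x / 3)) :
    |pertProfile α v w x - (3 / 2 * Real.exp (2 * x / 3) - α * Real.exp (x / 3))|
      ≤ 1 + 6 * (α + 1) ^ 2 + 2 * α * (α + 1) := by
  have hα := S.alpha_pos
  have h1 := S.two_thirds_sub_le x
  have h2 := S.le_two_thirds x
  have h3 := S.deriv_nonneg x
  have h4 := S.deriv_le_one x
  rw [pertProfile]
  set δ := 2 * x / 3 - v x with hδ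
  have hδ0 : 0 ≤ δ := by linarith
  have hZ : 0 < Real.exp (x / 3) := Real.exp_pos _
  have e0 : Real.exp (2 * x / 3) = Real.exp (x / 3) ^ 2 := by
    rw [sq, ← Real.exp_add]
    congr 1
    ring
  have e1 : Real.exp (v x) = Real.exp (x / 3) ^ 2 * (Real.exp δ)⁻¹ := by
    rw [sq, ← Real.exp_neg, ← Real.exp_add, ← Real.exp_add]
    congr 1
    ring
  have e2 : Real.exp (x - v x) = Real.exp (x / 3) * Real.exp δ := by
    rw [← Real.exp_add]
    congr 1
    ring
  rw [Real.exp_neg, ← div_eq_mul_inv, le_div_iff₀ hZ] at h1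
  rw [e0, e1, e2]
  set Z := Real.exp (x / 3)
  have hδ1 : δ ≤ 1 := by
    by_contra! hlt
    nlinarith
  have hu1 : 1 ≤ Real.exp δ := Real.one_le_exp hδ0
  have hu2 : Real.exp δ - 1 ≤ 2 * δ := by
    have := Real.abs_exp_sub_one_le (x := δ) (by rwa [abs_of_nonneg hδ0])
    rw [abs_of_nonneg hδ0] at this
    exact (le_abs_self _).trans this
  set u := Real.exp δ
  have hu0 : 0 < u := by linarith
  have e3 : 1 / 8 + ((Z * u) ^ 2 + 2 * (Z ^ 2 * u⁻¹) - 2 * α * (Z * u) - (w x - 1) ^ 2) / 2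
      - (3 / 2 * Z ^ 2 - α * Z)
      = 1 / 8 - (w x - 1) ^ 2 / 2 + (Z * (u - 1)) ^ 2 * ((u + 2) / u) / 2
        - α * (Z * (u - 1)) := by
    field_simp
    ring
  rw [e3]
  have h5 : 0 ≤ Z * (u - 1) := mul_nonneg hZ.le (by linarith)
  have h6 : Z * (u - 1) ≤ 2 * (α + 1) := by
    calc Z * (u - 1) ≤ Z * (2 * δ) := by gcongr
      _ ≤ _ := by linarith
  have h7 : (u + 2) / u ≤ 3 := by
    rw [div_le_iff₀ hu0]
    linarith
  have h8 : 0 ≤ (u + 2) / u := by positivity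
  have h9 : (Z * (u - 1)) ^ 2 * ((u + 2) / u) ≤ (2 * (α + 1)) ^ 2 * 3 := by gcongr
  have h10 : 0 ≤ (Z * (u - 1)) ^ 2 * ((u + 2) / u) := by positivity
  have h11 : α * (Z * (u - 1)) ≤ α * (2 * (α + 1)) := by gcongr
  have h12 : 0 ≤ α * (Z * (u - 1)) := by positivity
  have h13 : (w x - 1) ^ 2 ≤ 1 := by nlinarith
  have h14 : 0 ≤ (w x - 1) ^ 2 := sq_nonneg _
  have h15 : 0 < (α + 1) ^ 2 := by positivity
  rw [abs_le]
  constructor <;> nlinarith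

lemma profile_log_le (S : IsPertSol α 0 v w) {s : ℝ} (hs : 0 < s) :
    pertProfile α v w (Real.log s) - (1 - 4 * α ^ 2) / 8 ≤ 3 / 2 * s ^ ((2:ℝ) / 3) := by
  have h0 : Tendsto (fun s : ℝ => 3 / 2 * s ^ ((2:ℝ) / 3)) (𝓝[>] 0) (𝓝 0) := by
    have h1 : ContinuousAt (fun s : ℝ => 3 / 2 * s ^ ((2:ℝ) / 3)) 0 :=
      (Real.continuousAt_rpow_const 0 (2 / 3) (Or.inr (by norm_num))).const_mul _
    have h2 := h1.tendsto.mono_left (nhdsWithin_le_nhds (s := Ioi 0))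
    simpa [Real.zero_rpow] using h2
  have key := le_of_tendsto_of_hasDerivAt_nonneg hs
    (f := fun s => 3 / 2 * s ^ ((2:ℝ) / 3) - pertProfile α v w (Real.log s))
    (fun τ hτ => ((Real.hasDerivAt_rpow_const (p := 2 / 3) (Or.inl hτ.1.ne')).const_mul
      (3 / 2)).sub (S.hasDerivAt_profile_log hτ.1)) (fun τ hτ => ?_)
    (h0.sub S.tendsto_profile_log)
  · linarith
  · have h1 : Real.exp (v (Real.log τ) - Real.log τ) ≤ τ ^ ((2:ℝ) / 3 - 1) := by
      rw [Real.rpow_def_of_pos hτ.1]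
      gcongr
      linarith [S.le_two_thirds (Real.log τ)]
    linarith

lemma profile_log_mono (S : IsPertSol α 0 v w) :
    StrictMonoOn (fun s => pertProfile α v w (Real.log s)) (Ioi 0) := by
  refine strictMonoOn_of_deriv_pos (convex_Ioi 0)
    (fun s hs => (S.hasDerivAt_profile_log hs).continuousAt.continuousWithinAt) fun s hs => ?_
  rw [(S.hasDerivAt_profile_log (interior_subset hs)).deriv]
  exact Real.exp_pos _

lemma lt_profile_log (S : IsPertSol α 0 v w) {s : ℝ} (hs : 0 < s) :
    (1 - 4 * α ^ 2) / 8 < pertProfile α v w (Real.log s) :=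
  (le_of_tendsto_of_hasDerivAt_nonneg (half_pos hs)
    (fun _ hτ => S.hasDerivAt_profile_log hτ.1) (fun _ _ => (Real.exp_pos _).le)
    S.tendsto_profile_log).trans_lt
    (S.profile_log_mono (half_pos hs) hs (half_lt_self hs))

lemma profile_log_mul_le (S : IsPertSol α 0 v w) {l s : ℝ} (hl : 1 ≤ l) (hs : 0 < s) :
    pertProfile α v w (Real.log (l * s)) - (1 - 4 * α ^ 2) / 8
      ≤ l * (pertProfile α v w (Real.log s) - (1 - 4 * α ^ 2) / 8) := by
  have hl0 : 0 < l := by linarith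
  have hlt : Tendsto (fun s => l * s) (𝓝[>] 0) (𝓝[>] 0) := by
    refine tendsto_nhdsWithin_iff.2 ⟨?_, ?_⟩
    · have : ContinuousAt (fun s => l * s) 0 := by fun_prop
      simpa [ContinuousAt] using this.tendsto.mono_left (nhdsWithin_le_nhds (s := Ioi 0))
    · filter_upwards [self_mem_nhdsWithin] with s hs
      exact mul_pos hl0 hs
  have key := le_of_tendsto_of_hasDerivAt_nonneg hs
    (f := fun s => l * pertProfile α v w (Real.log s) - pertProfile α v w (Real.log (l * s)))
    (fun τ hτ => ((S.hasDerivAt_profile_log hτ.1).const_mul l).sub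
      ((S.hasDerivAt_profile_log (mul_pos hl0 hτ.1)).comp τ ((hasDerivAt_id τ).const_mul l)))
    (fun τ hτ => ?_) ((S.tendsto_profile_log.const_mul l).sub (S.tendsto_profile_log.comp hlt))
  · linarith
  · have h1 : Real.log τ ≤ Real.log (l * τ) :=
      Real.log_le_log hτ.1 (le_mul_of_one_le_left hτ.1.le hl)
    have h2 : Real.exp (v (Real.log (l * τ)) - Real.log (l * τ))
        ≤ Real.exp (v (Real.log τ) - Real.log τ) := Real.exp_le_exp.2 (S.antitone_sub h1)
    nlinarith

end IsPertSol

namespace IsPertOPS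

open Polynomial

variable {α : ℝ} {p : ℕ → ℝ → ℝ[X]} {h : ℕ → ℝ → ℝ}

/-- The logarithm of the scaled logarithmic derivative of the norm of index `n + 1`. -/
noncomputable def scaledLog (α : ℝ) (p : ℕ → ℝ → ℝ[X]) (h : ℕ → ℝ → ℝ) (n : ℕ) (x : ℝ) : ℝ :=
  Real.log ((2 * (n + 1) + 1 + α)
    * logDeriv α p h (n + 1) (Real.exp x / (2 * (n + 1) + 1 + α)))

/-- The derivative of `scaledLog`. -/
noncomputable def scaledLogDeriv (α : ℝ) (p : ℕ → ℝ → ℝ[X]) (h : ℕ → ℝ → ℝ) (n : ℕ)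
    (x : ℝ) : ℝ :=
  2 * (n + 1) + 1 + α + logDeriv α p h (n + 1) (Real.exp x / (2 * (n + 1) + 1 + α))
    + (2 * cross α p h n (Real.exp x / (2 * (n + 1) + 1 + α))
        - Real.exp x / (2 * (n + 1) + 1 + α))
      / logDeriv α p h (n + 1) (Real.exp x / (2 * (n + 1) + 1 + α))

lemma exp_scaledLog (S : IsPertOPS α p h) (n : ℕ) (x : ℝ) :
    Real.exp (scaledLog α p h n x) = (2 * (n + 1) + 1 + α)
      * logDeriv α p h (n + 1) (Real.exp x / (2 * (n + 1) + 1 + α)) := by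
  have hα := S.alpha_pos
  have hK : (0:ℝ) < 2 * (n + 1) + 1 + α := by positivity
  exact Real.exp_log (mul_pos hK (S.logDeriv_pos (div_pos (Real.exp_pos x) hK) (n + 1)))

lemma isPertSol (S : IsPertOPS α p h) (n : ℕ) :
    IsPertSol α (1 / (2 * (n + 1) + 1 + α) ^ 2) (scaledLog α p h n)
      (scaledLogDeriv α p h n) := by
  have hα := S.alpha_pos
  have hexp := S.exp_scaledLog n
  have hda := fun t (ht : 0 < t) => S.hasDerivAt_logDeriv ht n
  have hdb := fun t (ht : 0 < t) => S.hasDerivAt_cross ht n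
  set K : ℝ := 2 * (n + 1) + 1 + α with hK
  have hK0 : 0 < K := by positivity
  have ht : ∀ x, 0 < Real.exp x / K := fun x => div_pos (Real.exp_pos x) hK0
  have ha := fun x => S.logDeriv_pos (ht x) (n + 1)
  have hdt : ∀ x, HasDerivAt (fun x => Real.exp x / K) (Real.exp x / K) x := fun x =>
    (Real.hasDerivAt_exp x).div_const K
  have hdat := fun x => (hda _ (ht x)).comp x (hdt x)
  have hdbt := fun x => (hdb _ (ht x)).comp x (hdt x)
  have hx : ∀ x, Real.exp (x - scaledLog α p h n x)
      = (Real.exp x / K) / logDeriv α p h (n + 1) (Real.exp x / K) := fun x => by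
    rw [Real.exp_sub, hexp, div_div]
  refine ⟨hα, by positivity, fun x => ?_, fun x => ?_, fun x => ?_, ?_⟩
  · refine (((hdat x).const_mul K).log (mul_pos hK0 (ha x)).ne').congr_deriv ?_
    rw [scaledLogDeriv, ← hK]
    have h2 := (ha x).ne'
    have h3 := (ht x).ne'
    simp only [Function.comp_apply]
    rw [div_mul_cancel₀ _ h3]
    field_simp
    ring
  · refine (((hdat x).const_add K).add ((((hdbt x).const_mul 2).sub (hdt x)).div
      (hdat x) (ha x).ne')).congr_deriv ?_
    rw [pertForce, show 2 * scaledLog α p h n x = scaledLog α p h n x + scaledLog α p h n x by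
      ring, show 2 * (x - scaledLog α p h n x)
      = (x - scaledLog α p h n x) + (x - scaledLog α p h n x) by ring, Real.exp_add,
      Real.exp_add, hexp, hx]
    have h2 := (ha x).ne'
    have h3 := (ht x).ne'
    simp only [Function.comp_apply, Pi.sub_apply]
    have hKeq : α = K - (2 * (n + 1) + 1) := by rw [hK]; ring
    have hKn := hK0.ne'
    generalize logDeriv α p h (n + 1) (Real.exp x / K) = a at *
    generalize cross α p h n (Real.exp x / K) = b at *
    generalize Real.exp x / K = t at *
    clear_value K
    subst hKeq
    field_simp
    ring
  · rw [hx, le_div_iff₀ (ha x)]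
    nlinarith [S.logDeriv_le (ht x) (n + 1), sq_nonneg (logDeriv α p h (n + 1) (Real.exp x / K))]
  · have hK1 : 1 ≤ K := by
      have : (0:ℝ) ≤ n := n.cast_nonneg
      linarith
    refine ⟨1 + K, fun x => ?_⟩
    have h1 := S.le_logDeriv (ht x) (n + 1)
    push_cast at h1
    rw [← hK] at h1
    have h2 := ha x
    have h3 := ht x
    change -((1 + K) * (1 + |x|)) ≤ Real.log (K * logDeriv α p h (n + 1) (Real.exp x / K))
    rw [Real.le_log_iff_exp_le (mul_pos hK0 h2)]
    have h4 : Real.exp x = K * (Real.exp x / K) := by field_simp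
    have h5 : 1 + K ≤ Real.exp K := by linarith [Real.add_one_le_exp K]
    have h6 : Real.exp (-((1 + K) * (1 + |x|))) ≤ Real.exp (-K) * Real.exp (-|x|) := by
      rw [← Real.exp_add]
      gcongr
      nlinarith [abs_nonneg x]
    have h7 : Real.exp (-|x|) ≤ Real.exp x := Real.exp_le_exp.2 (neg_abs_le x)
    have h8 : Real.exp (-|x|) ≤ 1 := Real.exp_le_one_iff.2 (by simp)
    have h9 : Real.exp (-K) * (1 + K) ≤ 1 := by
      calc _ ≤ Real.exp (-K) * Real.exp K := by gcongr
        _ = 1 := by rw [← Real.exp_add]; simp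
    refine h6.trans ?_
    have h10 : 0 < Real.exp (-K) := Real.exp_pos _
    have h11 : 0 < Real.exp (-|x|) := Real.exp_pos _
    set A := logDeriv α p h (n + 1) (Real.exp x / K)
    by_contra! hlt
    have h12 : Real.exp (-K) * Real.exp (-|x|) * (1 + K) ≤ Real.exp (-|x|) := by nlinarith
    have h13 : K * A * (1 + K) < Real.exp (-|x|) := by nlinarith
    have h14 : A ≤ 1 := by
      by_contra! hA
      nlinarith
    have h15 : A ^ 2 ≤ A := by nlinarith
    have h16 : Real.exp x ≤ K * (A ^ 2 + K * A) := by
      rw [h4]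
      gcongr
    nlinarith [mul_pos hK0 h2]

lemma logDeriv_eq (S : IsPertOPS α p h) (n : ℕ) {t : ℝ} (ht : 0 < t) :
    logDeriv α p h (n + 1) t = Real.exp (scaledLog α p h n
      (Real.log ((2 * (n + 1) + 1 + α) * t))) / (2 * (n + 1) + 1 + α) := by
  have hα := S.alpha_pos
  have hK : (0:ℝ) < 2 * (n + 1) + 1 + α := by positivity
  rw [exp_scaledLog S, Real.exp_log (mul_pos hK ht), mul_div_cancel_left₀ _ hK.ne',
    mul_div_cancel_left₀ _ hK.ne']

lemma log_norm_add_profile (S : IsPertOPS α p h) {V W : ℝ → ℝ} (hS : IsPertSol α 0 V W)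
    (n : ℕ) (c : ℝ) {t : ℝ} (ht : 0 < t) :
    HasDerivAt (fun t => Real.log (h (n + 1) t)
        + c * (pertProfile α V W (Real.log ((2 * (n + 1) + 1 + α) * t))
          / (2 * (n + 1) + 1 + α)))
      ((c * Real.exp (V (Real.log ((2 * (n + 1) + 1 + α) * t)))
        - Real.exp (scaledLog α p h n (Real.log ((2 * (n + 1) + 1 + α) * t))))
          / ((2 * (n + 1) + 1 + α) * t)) t ∧
    Tendsto (fun t => Real.log (h (n + 1) t)
        + c * (pertProfile α V W (Real.log ((2 * (n + 1) + 1 + α) * t))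
          / (2 * (n + 1) + 1 + α))) (𝓝[>] 0)
      (𝓝 (Real.log ((n + 1).factorial * Real.Gamma ((n + 1 : ℕ) + 1 + α))
        + c * ((1 - 4 * α ^ 2) / 8 / (2 * (n + 1) + 1 + α)))) := by
  have hα := S.alpha_pos
  have hlog := S.logDeriv_eq n ht
  set K : ℝ := 2 * (n + 1) + 1 + α with hK
  have hK0 : 0 < K := by positivity
  constructor
  · have h1 := (S.hasDerivAt_norm_eq ht (n + 1)).log (S.norm_pos ht (n + 1)).ne'
    have h2 := (hS.hasDerivAt_profile_log (mul_pos hK0 ht)).comp t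
      ((hasDerivAt_id t).const_mul K)
    refine (h1.add ((h2.div_const K).const_mul c)).congr_deriv ?_
    rw [hlog, Real.exp_sub, Real.exp_log (mul_pos hK0 ht)]
    have h3 := (S.norm_pos ht (n + 1)).ne'
    field_simp
    ring
  · have hlt : Tendsto (fun s => K * s) (𝓝[>] 0) (𝓝[>] 0) := by
      refine tendsto_nhdsWithin_iff.2 ⟨?_, ?_⟩
      · have : ContinuousAt (fun s => K * s) 0 := by fun_prop
        simpa [ContinuousAt] using this.tendsto.mono_left (nhdsWithin_le_nhds (s := Ioi 0))
      · filter_upwards [self_mem_nhdsWithin] with s hs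
        exact mul_pos hK0 hs
    refine ((S.tendsto_norm (n + 1)).log ?_).add
      (((hS.tendsto_profile_log.comp hlt).div_const K).const_mul c)
    have : 0 < Real.Gamma (((n + 1 : ℕ) : ℝ) + 1 + α) := Real.Gamma_pos_of_pos (by positivity)
    positivity

lemma log_norm_le (S : IsPertOPS α p h) {V W : ℝ → ℝ} (hS : IsPertSol α 0 V W)
    (n : ℕ) {t : ℝ} (ht : 0 < t) :
    Real.log ((n + 1).factorial * Real.Gamma ((n + 1 : ℕ) + 1 + α)) - Real.log (h (n + 1) t)
      ≤ (pertProfile α V W (Real.log ((2 * (n + 1) + 1 + α) * t)) - (1 - 4 * α ^ 2) / 8)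
        / (2 * (n + 1) + 1 + α) := by
  have hα := S.alpha_pos
  have h0 := fun τ (hτ : 0 < τ) => (S.log_norm_add_profile hS n 1 hτ).1
  have hL := (S.log_norm_add_profile hS n 1 ht).2
  have key := le_of_tendsto_of_hasDerivAt_nonneg ht (fun τ hτ => h0 τ hτ.1)
    (fun τ hτ => ?_) hL
  · rw [sub_div]
    linarith
  · have h1 := IsPertSol.mono (S.isPertSol n) hS (by positivity)
      (Real.log ((2 * (n + 1) + 1 + α) * τ))
    have h2 := Real.exp_le_exp.2 h1
    have := hτ.1
    refine div_nonneg (by linarith) (by positivity)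

lemma le_log_norm (S : IsPertOPS α p h) {V W : ℝ → ℝ} (hS : IsPertSol α 0 V W)
    (n : ℕ) {t d : ℝ} (ht : 0 < t) (htd : t ≤ d) :
    (1 - (2 + d) / (2 * (n + 1) + 1 + α))
      * ((pertProfile α V W (Real.log ((2 * (n + 1) + 1 + α) * t)) - (1 - 4 * α ^ 2) / 8)
        / (2 * (n + 1) + 1 + α))
      ≤ Real.log ((n + 1).factorial * Real.Gamma ((n + 1 : ℕ) + 1 + α))
        - Real.log (h (n + 1) t) := by
  have hα := S.alpha_pos
  set B := (2 + d) / (2 * (n + 1) + 1 + α) with hB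
  have h0 := fun τ (hτ : 0 < τ) => (S.log_norm_add_profile hS n (1 - B) hτ).1.neg
  have hL := (S.log_norm_add_profile hS n (1 - B) ht).2.neg
  have key := le_of_tendsto_of_hasDerivAt_nonneg ht (fun τ hτ => h0 τ hτ.1)
    (fun τ hτ => ?_) hL
  · rw [sub_div, mul_sub]
    simp only [Pi.neg_apply] at key
    linarith
  · have hτ0 := hτ.1
    have h1 := IsPertSol.sub_le (S.isPertSol n) hS (Real.log ((2 * (n + 1) + 1 + α) * τ))
    set K : ℝ := 2 * (n + 1) + 1 + α with hK
    have hn : (0:ℝ) ≤ n := n.cast_nonneg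
    have hK1 : 1 ≤ K := by linarith
    have hK0 : 0 < K := by linarith
    have hKτ : 0 < K * τ := by positivity
    rw [IsPertSol.exp_two_mul_log_div_three hKτ] at h1
    have h2 : (K * τ) ^ ((2:ℝ) / 3) ≤ 1 + K * d := by
      have h3 : (K * τ) ^ ((2:ℝ) / 3) ≤ (1 + K * τ) ^ (1:ℝ) := by
        calc _ ≤ (1 + K * τ) ^ ((2:ℝ) / 3) := by gcongr; linarith
          _ ≤ _ := Real.rpow_le_rpow_of_exponent_le (by linarith) (by norm_num)
      rw [Real.rpow_one] at h3
      have : K * τ ≤ K * d := by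
        gcongr
        exact hτ.2.trans htd
      linarith
    have h4 : 1 / K ^ 2 * (1 + (K * τ) ^ ((2:ℝ) / 3)) ≤ B := by
      calc _ ≤ 1 / K ^ 2 * (1 + (1 + K * d)) := by gcongr
        _ ≤ 1 / K ^ 2 * (2 * K + K * d) :=
          mul_le_mul_of_nonneg_left (by linarith) (by positivity)
        _ = B := by rw [hB]; field_simp
    set x := Real.log (K * τ)
    have h5 := Real.add_one_le_exp (scaledLog α p h n x - V x)
    rw [Real.exp_sub, le_div_iff₀ (Real.exp_pos _)] at h5
    have h6 : (1 - B) * Real.exp (V x) ≤ Real.exp (scaledLog α p h n x) :=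
      le_trans (by gcongr; linarith) h5
    rw [← neg_div]
    exact div_nonneg (by linarith) hKτ.le

end IsPertOPS

lemma exists_relative_error {c y z : ℝ} (hz0 : 0 < z) (hz1 : z ≤ 1) (hy : y ≤ z)
    (hc : (1 - c) * z ≤ y) (hc0 : 0 ≤ c) :
    ∃ ε : ℝ, |ε| ≤ c + z ∧ Real.exp y = 1 + z * (1 + ε) := by
  refine ⟨(Real.exp y - 1) / z - 1, ?_, by field_simp; ring⟩
  have h1 : Real.exp z - 1 - z ≤ z ^ 2 :=
    (le_abs_self _).trans (Real.abs_exp_sub_one_sub_id_le (by rwa [abs_of_pos hz0]))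
  have h2 : Real.exp y ≤ Real.exp z := Real.exp_le_exp.2 hy
  have h3 := Real.add_one_le_exp y
  have h4 : (Real.exp y - 1) / z ≤ 1 + z := by
    rw [div_le_iff₀ hz0]
    nlinarith
  have h5 : 1 - c ≤ (Real.exp y - 1) / z := by
    rw [le_div_iff₀ hz0]
    linarith
  rw [abs_le]
  constructor <;> linarith

namespace IsPertSol

variable {α : ℝ} {V W : ℝ → ℝ}

lemma profile_div_pos (hS : IsPertSol α 0 V W) {n : ℕ} (hn : 0 < n) {t : ℝ} (ht : 0 < t) :
    0 < (8 * pertProfile α V W (Real.log (2 * n * t)) + 4 * α ^ 2 - 1) / (32 * n) := by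
  have hn' : (0:ℝ) < n := by exact_mod_cast hn
  have h1 := hS.lt_profile_log (s := 2 * n * t) (by positivity)
  exact div_pos (by linarith) (by positivity)

lemma profile_div_le (hS : IsPertSol α 0 V W) {n : ℕ} (hn : 0 < n) {t d : ℝ} (ht : 0 < t)
    (htd : t ≤ d) :
    (8 * pertProfile α V W (Real.log (2 * n * t)) + 4 * α ^ 2 - 1) / (32 * n)
      ≤ 3 / 8 * (2 * d) ^ ((2:ℝ) / 3) * (n : ℝ) ^ (-(1:ℝ) / 3) := by
  have hn' : (0:ℝ) < n := by exact_mod_cast hn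
  have h1 := hS.profile_log_le (s := 2 * n * t) (by positivity)
  have h2 : (2 * n * t) ^ ((2:ℝ) / 3) ≤ (2 * d) ^ ((2:ℝ) / 3) * (n : ℝ) ^ ((2:ℝ) / 3) := by
    rw [← Real.mul_rpow (by linarith) hn'.le]
    refine Real.rpow_le_rpow (by positivity) ?_ (by norm_num)
    nlinarith
  have h3 : (n : ℝ) ^ ((2:ℝ) / 3) = (n : ℝ) ^ (-(1:ℝ) / 3) * n := by
    rw [← Real.rpow_add_one hn'.ne']
    norm_num
  rw [div_le_iff₀ (by positivity)]
  rw [h3] at h2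
  linarith

end IsPertSol

namespace IsPertOPS

open Polynomial

variable {α : ℝ} {p : ℕ → ℝ → ℝ[X]} {h : ℕ → ℝ → ℝ}

lemma half_log_norm_bounds (S : IsPertOPS α p h) {V W : ℝ → ℝ} (hS : IsPertSol α 0 V W)
    {n : ℕ} (hn : 0 < n) {t d : ℝ} (ht : 0 < t) (htd : t ≤ d) (hnd : 2 + d ≤ n) :
    (1 - (3 + d + α) / n)
        * ((8 * pertProfile α V W (Real.log (2 * n * t)) + 4 * α ^ 2 - 1) / (32 * n))
      ≤ (Real.log (n.factorial * Real.Gamma (n + 1 + α)) - Real.log (h n t)) / 2 ∧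
    (Real.log (n.factorial * Real.Gamma (n + 1 + α)) - Real.log (h n t)) / 2
      ≤ (8 * pertProfile α V W (Real.log (2 * n * t)) + 4 * α ^ 2 - 1) / (32 * n) := by
  have hα := S.alpha_pos
  have hd : 0 < d := ht.trans_le htd
  have hz := hS.profile_div_pos hn ht
  obtain ⟨n, rfl⟩ := Nat.exists_eq_succ_of_ne_zero hn.ne'
  rw [Nat.succ_eq_add_one] at *
  have h1 := S.log_norm_le hS n ht
  have h2 := S.le_log_norm hS n ht htd
  set N : ℝ := ((n + 1 : ℕ) : ℝ) with hN
  have hN' : (n : ℝ) + 1 = N := by rw [hN]; push_cast; ring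
  rw [hN'] at h1 h2
  have hN0 : 0 < N := by rw [hN]; positivity
  set K : ℝ := 2 * N + 1 + α with hK
  have hK0 : 0 < K := by positivity
  have hs : 0 < 2 * N * t := by positivity
  have hKt : K * t = K / (2 * N) * (2 * N * t) := by field_simp
  have hl : 1 ≤ K / (2 * N) := by
    rw [le_div_iff₀ (by positivity)]
    linarith
  have h3 := hS.profile_log_mul_le hl hs
  have h4 := hS.profile_log_mono.monotoneOn hs (show K * t ∈ Ioi 0 by exact mul_pos hK0 ht)
    (show 2 * N * t ≤ K * t by gcongr; linarith)
  rw [← hKt] at h3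
  set z := (8 * pertProfile α V W (Real.log (2 * N * t)) + 4 * α ^ 2 - 1) / (32 * N) with hz'
  have hzr : pertProfile α V W (Real.log (2 * N * t)) - (1 - 4 * α ^ 2) / 8 = 4 * N * z := by
    rw [hz']
    field_simp
    ring
  rw [hzr] at h3
  have h5 : K / (2 * N) * (4 * N * z) = 2 * K * z := by
    field_simp
    ring
  rw [h5] at h3
  set R := pertProfile α V W (Real.log (K * t)) - (1 - 4 * α ^ 2) / 8 with hR
  have h6 : 4 * N * z ≤ R := by linarith
  have h7 : R / K ≤ 2 * z := by
    rw [div_le_iff₀ hK0]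
    linarith
  refine ⟨?_, by linarith⟩
  have h8 : 0 ≤ 1 - (2 + d) / K := by
    rw [sub_nonneg, div_le_one hK0]
    linarith
  have h9 : (1 - (2 + d) / K) * (4 * N * z / K) ≤ (1 - (2 + d) / K) * (R / K) := by gcongr
  have h10 : (1 - (3 + d + α) / N) * z ≤ (1 - (2 + d) / K) * (4 * N * z / K) / 2 := by
    have h11 : 4 * N * z / K = 2 * (1 - (1 + α) / K) * z := by
      field_simp
      rw [hK]
      ring
    have h12 : (3 + d + α) / K ≤ (3 + d + α) / N := by
      gcongr
      linarith
    have h13 : 0 ≤ (2 + d) / K * ((1 + α) / K) := by positivity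
    have h14 : (3 + d + α) / K = (2 + d) / K + (1 + α) / K := by ring
    have h15 : 1 - (3 + d + α) / N ≤ (1 - (2 + d) / K) * (1 - (1 + α) / K) := by nlinarith
    rw [h11]
    nlinarith
  linarith

lemma exists_pertSol (S : IsPertOPS α p h) : ∃ V W, IsPertSol α 0 V W := by
  have hα := S.alpha_pos
  refine IsPertSol.exists_limit (κ := fun n : ℕ => 1 / (2 * ((n : ℝ) + 1) + 1 + α) ^ 2)
    (fun n => S.isPertSol n) (fun m n hmn => ?_) ?_
  · have : (m : ℝ) ≤ n := by exact_mod_cast hmn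
    dsimp only
    gcongr
  · have h1 : Tendsto (fun n : ℕ => 1 / ((n : ℝ) + 1)) atTop (𝓝 0) :=
      tendsto_one_div_add_atTop_nhds_zero_nat
    refine squeeze_zero (fun n => by positivity) (fun n => ?_) h1
    have hn : (0:ℝ) ≤ n := n.cast_nonneg
    gcongr
    nlinarith

lemma leading_coeff_eq (S : IsPertOPS α p h) {V W : ℝ → ℝ} (hS : IsPertSol α 0 V W) {d : ℝ}
    (hd : 0 < d) :
    ∃ C > (0:ℝ), ∃ N : ℕ, ∀ n ≥ N, ∀ t ∈ Ioc (0:ℝ) d,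
      ∃ ε : ℝ, |ε| ≤ C * (n : ℝ) ^ (-(1:ℝ) / 3) ∧
        (h n t) ^ (-(1:ℝ) / 2)
          = ((Nat.factorial n : ℝ) * Real.Gamma ((n : ℝ) + 1 + α)) ^ (-(1:ℝ) / 2) *
            (1 + ((8 * pertProfile α V W (Real.log (2 * n * t)) + 4 * α ^ 2 - 1) / (32 * n))
              * (1 + ε)) := by
  have hα := S.alpha_pos
  have hlim : Tendsto (fun n : ℕ => 3 / 8 * (2 * d) ^ ((2:ℝ) / 3) * (n : ℝ) ^ (-(1:ℝ) / 3))
      atTop (𝓝 0) := by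
    have h1 := (tendsto_rpow_neg_atTop (show (0:ℝ) < 1 / 3 by norm_num)).comp
      tendsto_natCast_atTop_atTop
    have h2 := h1.const_mul (3 / 8 * (2 * d) ^ ((2:ℝ) / 3))
    rw [mul_zero] at h2
    refine h2.congr fun n => ?_
    simp only [Function.comp_apply]
    norm_num
  obtain ⟨N₁, hN₁⟩ := eventually_atTop.1 (hlim.eventually_le_const one_pos)
  obtain ⟨N₂, hN₂⟩ := exists_nat_ge (2 + d)
  refine ⟨3 + d + α + 3 / 8 * (2 * d) ^ ((2:ℝ) / 3), by positivity, max (max N₁ N₂) 1,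
    fun n hn t ht => ?_⟩
  have hn0 : 0 < n := (le_max_right _ _).trans hn
  have hn1 : N₁ ≤ n := (le_max_left _ _).trans ((le_max_left _ _).trans hn)
  have hn2 : (N₂ : ℝ) ≤ n := by
    exact_mod_cast (le_max_right _ _).trans ((le_max_left _ _).trans hn)
  have hn' : (1:ℝ) ≤ n := by exact_mod_cast hn0
  obtain ⟨h1, h2⟩ := S.half_log_norm_bounds hS hn0 ht.1 ht.2 (hN₂.trans hn2)
  have h3 := hS.profile_div_le hn0 ht.1 ht.2
  obtain ⟨ε, hε, he⟩ := exists_relative_error (hS.profile_div_pos hn0 ht.1)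
    (h3.trans (hN₁ n hn1)) h2 h1 (by positivity)
  refine ⟨ε, hε.trans ?_, ?_⟩
  · have h4 : (n : ℝ)⁻¹ ≤ (n : ℝ) ^ (-(1:ℝ) / 3) := by
      rw [← Real.rpow_neg_one]
      exact Real.rpow_le_rpow_of_exponent_le hn' (by norm_num)
    rw [add_mul, div_eq_mul_inv]
    gcongr
  · have hΓ : 0 < Real.Gamma ((n : ℝ) + 1 + α) := Real.Gamma_pos_of_pos (by positivity)
    rw [← he, Real.rpow_def_of_pos (S.norm_pos ht.1 n), Real.rpow_def_of_pos (by positivity),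
      ← Real.exp_add]
    congr 1
    ring

end IsPertOPS

lemma exists_isPertOPS {α : ℝ} (hα : 0 < α) {P : ℕ → ℝ → ℝ → ℝ} {h : ℕ → ℝ → ℝ}
    (hmonic : ∀ m : ℕ, ∀ τ > (0:ℝ), ∃ p : Polynomial ℝ,
      p.Monic ∧ p.natDegree = m ∧ ∀ x, P m τ x = p.eval x)
    (horth : ∀ j k : ℕ, ∀ τ > (0:ℝ),
      (∫ x in Ioi (0:ℝ), P j τ x * P k τ x * pertLagWeight α τ x)
        = if j = k then h j τ else 0) :
    ∃ p : ℕ → ℝ → Polynomial ℝ, IsPertOPS α p h := by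
  choose! p hp using hmonic
  refine ⟨p, hα, fun n t ht => (hp n t ht).1, fun n t ht => (hp n t ht).2.1,
    fun j k t ht => ?_⟩
  rw [← horth j k t ht, pertFunctional.eq_integral ht]
  refine integral_congr_ae (Eventually.of_forall fun x => ?_)
  simp only [Polynomial.eval_mul, (hp j t ht).2.2, (hp k t ht).2.2, pertLagWeight]
  simp

theorem leading_coeff_asymptotics
    (α d : ℝ) (hα : 0 < α) (hd : 0 < d)
    (P : ℕ → ℝ → ℝ → ℝ) (h : ℕ → ℝ → ℝ)
    (hmonic : ∀ m : ℕ, ∀ τ > (0:ℝ), ∃ p : Polynomial ℝ,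
      p.Monic ∧ p.natDegree = m ∧ ∀ x, P m τ x = p.eval x)
    (horth : ∀ j k : ℕ, ∀ τ > (0:ℝ),
      (∫ x in Ioi (0:ℝ), P j τ x * P k τ x * pertLagWeight α τ x)
        = if j = k then h j τ else 0)
    (hpos : ∀ j : ℕ, ∀ τ > (0:ℝ), 0 < h j τ) :
    ∃ r : ℝ → ℝ,
      (∀ s > (0:ℝ), ContDiffAt ℝ (⊤ : ℕ∞) r s) ∧
      (∀ s > (0:ℝ),
        2 * s ^ 2 * deriv r s * deriv (deriv (deriv r)) s
          - s ^ 2 * (deriv (deriv r) s) ^ 2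
          + 2 * s * deriv r s * deriv (deriv r) s
          - 4 * s * (deriv r s) ^ 3
          + (2 * r s - 1 / 4) * (deriv r s) ^ 2 + 1 = 0) ∧
      Tendsto r (𝓝[>] (0:ℝ)) (𝓝 ((1 - 4 * α ^ 2) / 8)) ∧
      (∃ M > (0:ℝ), ∃ s₁ > (0:ℝ), ∀ s ≥ s₁,
        |r s - ((3 / 2) * s ^ ((2:ℝ) / 3) - α * s ^ ((1:ℝ) / 3))| ≤ M) ∧
      ∃ C > (0:ℝ), ∃ N : ℕ, ∀ n ≥ N, ∀ t ∈ Ioc (0:ℝ) d,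
        ∃ ε : ℝ, |ε| ≤ C * (n : ℝ) ^ (-(1:ℝ) / 3) ∧
          (h n t) ^ (-(1:ℝ) / 2)
            = ((Nat.factorial n : ℝ) * Real.Gamma ((n : ℝ) + 1 + α)) ^ (-(1:ℝ) / 2) *
              (1 + ((8 * r (2 * n * t) + 4 * α ^ 2 - 1) / (32 * n)) * (1 + ε)) := by
  obtain ⟨p, S⟩ := exists_isPertOPS hα hmonic horth
  obtain ⟨V, W, hS⟩ := S.exists_pertSol
  refine ⟨fun s => pertProfile α V W (Real.log s), fun s hs => ?_,
    fun s hs => hS.profile_ode rfl hs, hS.tendsto_profile_log, ?_, S.leading_coeff_eq hS hd⟩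
  · exact hS.contDiff_profile.contDiffAt.comp s (Real.contDiffAt_log.2 (ne_of_gt hs))
  · refine ⟨1 + 6 * (α + 1) ^ 2 + 2 * α * (α + 1), by positivity, (α + 1) ^ 3, by positivity,
      fun s hs => ?_⟩
    have hs0 : 0 < s := lt_of_lt_of_le (by positivity) hs
    have h1 : α + 1 ≤ Real.exp (Real.log s / 3) := by
      by_contra! hlt
      have h3 : Real.exp (Real.log s / 3) ^ 3 < (α + 1) ^ 3 :=
        pow_lt_pow_left₀ hlt (Real.exp_pos _).le (by norm_num)
      rw [← Real.exp_nat_mul, show ((3 : ℕ) : ℝ) * (Real.log s / 3) = Real.log s by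
        push_cast; ring, Real.exp_log hs0] at h3
      linarith
    have h2 := hS.abs_profile_sub_le h1
    rwa [IsPertSol.exp_two_mul_log_div_three hs0, IsPertSol.exp_log_div_three hs0] at h2
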